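/- arXiv:2109.04415 — 3 statements merged into one kernel-verified Lean document; each statement's English description precedes it below -/
import Mathlib

section
/- There is an absolute constant c > 0 such that the following holds. Let k ≥ 2, let ℓ, n be integers with 2(k−1) ≤ ℓ ≤ n, let ε ∈ (0,1], and let {H_u}_{u∈[p]} be an (ε,ℓ)-regular p-bipartite k-uniform hypergraph on [n]. Set N := binom(2n,ℓ), let D be the Kikuchi constant, and let Δ := c^{k−1} · ε^{−4} · (ln(32 p N / (ε² D)))^{2(k−1)}. Then the number of ℓ-element subsets S of [n]×{1,2} for which γ_u(S) > Δ for some u ∈ [p] is at most ε² D / 16. -/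
open Finset
open scoped Classical

/-- The first clone `C^(1) = C × {1}` of a set `C ⊆ [n]`, inside `[n] × {1,2}`. -/
def clone1 {n : ℕ} (C : Finset (Fin n)) : Finset (Fin n × Fin 2) :=
  C.image (fun i => (i, 0))

/-- The second clone `C^(2) = C × {2}` of a set `C ⊆ [n]`, inside `[n] × {1,2}`. -/
def clone2 {n : ℕ} (C : Finset (Fin n)) : Finset (Fin n × Fin 2) :=
  C.image (fun i => (i, 1))

/-- The relation `S ↔_{C,C'} T` defining the nonzero entries of the Kikuchi matrix:
`S ⊕ T = C^(1) ⊕ C'^(2)` together with the appropriate intersection-size conditions,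
depending on the parity of `k`. -/
def KikRel (k : ℕ) {n : ℕ} (C C' : Finset (Fin n))
    (S T : Finset (Fin n × Fin 2)) : Prop :=
  (S \ T) ∪ (T \ S) = (clone1 C \ clone2 C') ∪ (clone2 C' \ clone1 C) ∧
  ((Odd k ∧
      (S ∩ clone1 C).card = (k-1)/2 ∧ (S ∩ clone2 C').card = (k-1)/2 ∧
      (T ∩ clone1 C).card = (k-1)/2 ∧ (T ∩ clone2 C').card = (k-1)/2) ∨
   (Even k ∧
      (((S ∩ clone1 C).card = k/2 ∧ (T ∩ clone2 C').card = k/2 ∧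
        (S ∩ clone2 C').card = (k-2)/2 ∧ (T ∩ clone1 C).card = (k-2)/2) ∨
       ((S ∩ clone1 C).card = (k-2)/2 ∧ (T ∩ clone2 C').card = (k-2)/2 ∧
        (S ∩ clone2 C').card = k/2 ∧ (T ∩ clone1 C).card = k/2))))

/-- The Kikuchi constant `D`. -/
def kikD (k n ℓ : ℕ) : ℕ :=
  if Odd k then
    ((k-1).choose ((k-1)/2))^2 * ((2*n - 2*(k-1)).choose (ℓ - (k-1)))
  else
    2 * ((k-1).choose (k/2)) * ((k-1).choose ((k-2)/2)) * ((2*n - 2*(k-1)).choose (ℓ - (k-1)))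

/-- The level-`ℓ` Kikuchi matrix `A = Σ_u A_u` of the `p`-bipartite `k`-uniform
hypergraph whose `j`-th hyperedge lies in partition `π j` and has `(k−1)`-element set
`Ed j`, with coefficients `b j` (distinct indices `j` encode distinct multiset
elements). Its entry at `(S,T)` is `Σ b_j · b_{j'}` over ordered pairs of distinct
hyperedge indices `j ≠ j'` in a common partition with `S ↔_{Ed j, Ed j'} T`. -/
noncomputable def kikA (k n p m : ℕ) (π : Fin m → Fin p) (Ed : Fin m → Finset (Fin n))
    (b : Fin m → ℝ) (S T : Finset (Fin n × Fin 2)) : ℝ :=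
  ∑ j : Fin m, ∑ j' : Fin m,
    if j ≠ j' ∧ π j = π j' ∧ KikRel k (Ed j) (Ed j') S T then b j * b j' else 0

/-- The collection of all `ℓ`-element subsets of `[n] × {1,2}`. -/
def ellSubsets (n ℓ : ℕ) : Finset (Finset (Fin n × Fin 2)) :=
  Finset.univ.filter (fun S => S.card = ℓ)

/-- The butterfly degree `γ_u(S)` with respect to the partition `u` of the bipartite
hypergraph `(π, Ed)`: the number of ordered pairs of distinct hyperedge indices
`j ≠ j'` in partition `u`, counted with the indicator that
`S ∩ (Ed j^(1) ∪ Ed j'^(2))` is a `(k−1)`-element set `R` with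
`{|R ∩ Ed j^(1)|, |R ∩ Ed j'^(2)|} = {⌈(k−1)/2⌉, ⌊(k−1)/2⌋}`. -/
noncomputable def butterflyDegPart (k n p m : ℕ) (π : Fin m → Fin p)
    (Ed : Fin m → Finset (Fin n)) (u : Fin p) (S : Finset (Fin n × Fin 2)) : ℕ :=
  ∑ j : Fin m, ∑ j' : Fin m,
    if j ≠ j' ∧ π j = u ∧ π j' = u then
      (Finset.univ.filter (fun R : Finset (Fin n × Fin 2) =>
        R.card = k - 1 ∧
        (((R ∩ clone1 (Ed j)).card = k/2 ∧ (R ∩ clone2 (Ed j')).card = (k-1)/2) ∨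
         ((R ∩ clone1 (Ed j)).card = (k-1)/2 ∧ (R ∩ clone2 (Ed j')).card = k/2)) ∧
        S ∩ (clone1 (Ed j) ∪ clone2 (Ed j')) = R)).card
    else 0


lemma choose_sub_sub_le {M ℓ : ℕ} (hℓ : ℓ ≤ M) (r : ℕ) (hr : r ≤ ℓ) :
    ((M - r).choose (ℓ - r) : ℝ) ≤ (M.choose ℓ : ℝ) * ((ℓ : ℝ) / M) ^ r := by
  induction r with
  | zero => simp
  | succ r ih =>
    obtain ⟨a, rfl⟩ := Nat.exists_eq_add_of_le hr
    obtain ⟨b, rfl⟩ := Nat.exists_eq_add_of_le hℓ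
    have ih := ih (by omega)
    have e1 : r + 1 + a + b - (r + 1) = a + b := by omega
    have e2 : r + 1 + a - (r + 1) = a := by omega
    have e3 : r + 1 + a + b - r = a + b + 1 := by omega
    have e4 : r + 1 + a - r = a + 1 := by omega
    rw [e1, e2]
    rw [e3, e4] at ih
    have h := Nat.add_one_mul_choose_eq (a + b) a
    have h' : ((a : ℝ) + b + 1) * ((a + b).choose a : ℝ) =
        ((a + b + 1).choose (a + 1) : ℝ) * (a + 1) := by exact_mod_cast h
    set x : ℝ := ((a + b).choose a : ℝ)
    set y : ℝ := ((a + b + 1).choose (a + 1) : ℝ)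
    have hy : 0 ≤ y := by positivity
    have hxy : x ≤ y * (((r + 1 + a : ℕ) : ℝ) / ((r + 1 + a + b : ℕ) : ℝ)) := by
      have hx : x = y * (a + 1) / (a + b + 1) := by
        rw [← h']; field_simp
      rw [hx, mul_div_assoc]
      refine mul_le_mul_of_nonneg_left ?_ hy
      rw [div_le_div_iff₀ (by positivity) (by positivity)]
      push_cast
      nlinarith [mul_nonneg (Nat.cast_nonneg (α := ℝ) r) (Nat.cast_nonneg (α := ℝ) b)]
    calc x ≤ y * (((r + 1 + a : ℕ) : ℝ) / ((r + 1 + a + b : ℕ) : ℝ)) := hxy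
      _ ≤ _ := by
        rw [pow_succ, ← mul_assoc]
        gcongr

section moment

variable {V ι : Type*} [DecidableEq V]

/-- If for every `Q` the number of sets `R e` containing `Q` is suitably bounded, then so is the
weighted count of the sets `R e` by their part outside any set `U` that is not too large. -/
lemma sum_pow_card_sdiff_le (J : Finset ι) (R : ι → Finset V) {s : ℕ}
    (hR : ∀ e ∈ J, (R e).card = s) {ρ K τ : ℝ} (hρ : 0 ≤ ρ) (hτ : 1 ≤ τ)
    (hK : ∀ Q : Finset V, Q.card ≤ s →
      ((J.filter (fun e => Q ⊆ R e)).card : ℝ) * ρ ^ (s - Q.card) ≤ K)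
    (U : Finset V) (hU : (U.card : ℝ) ≤ s * τ) :
    ∑ e ∈ J, ρ ^ (R e \ U).card ≤ K * (Real.exp 1 * τ) ^ s := by
  have hK0 : 0 ≤ K := le_trans (by positivity) (hK ∅ (by simp))
  have hτ0 : 0 < τ := by linarith
  calc ∑ e ∈ J, ρ ^ (R e \ U).card
      = ∑ e ∈ J, ∑ Q ∈ U.powerset, if R e ∩ U = Q then ρ ^ (s - Q.card) else 0 := by
        refine sum_congr rfl fun e he => ?_
        rw [sum_ite_eq, if_pos (by simp), card_sdiff, hR e he, inter_comm]
    _ ≤ ∑ e ∈ J, ∑ Q ∈ U.powerset, if Q ⊆ R e then ρ ^ (s - Q.card) else 0 := by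
        refine sum_le_sum fun e _ => sum_le_sum fun Q _ => ?_
        by_cases h : R e ∩ U = Q
        · rw [if_pos h, if_pos (h ▸ inter_subset_left)]
        · rw [if_neg h]; split_ifs <;> positivity
    _ = ∑ Q ∈ U.powerset, ((J.filter (fun e => Q ⊆ R e)).card : ℝ) * ρ ^ (s - Q.card) := by
        rw [sum_comm]
        refine sum_congr rfl fun Q _ => ?_
        rw [← sum_filter, sum_const, nsmul_eq_mul]
    _ ≤ ∑ Q ∈ U.powerset, K * τ ^ s * (1 / τ) ^ Q.card := by
        refine sum_le_sum fun Q _ => ?_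
        by_cases hQ : Q.card ≤ s
        · refine (hK Q hQ).trans ?_
          have : 1 ≤ τ ^ s * (1 / τ) ^ Q.card := by
            rw [one_div, inv_pow, ← div_eq_mul_inv, one_le_div (by positivity)]
            exact pow_le_pow_right₀ hτ hQ
          nlinarith
        · rw [filter_false_of_mem]
          · simp; positivity
          · intro e he h
            exact hQ (hR e he ▸ card_le_card h)
    _ = K * τ ^ s * (1 / τ + 1) ^ U.card := by
        rw [← mul_sum, ← sum_pow_mul_eq_add_pow]; simp
    _ ≤ K * τ ^ s * Real.exp 1 ^ s := by
        gcongr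
        calc (1 / τ + 1) ^ U.card ≤ Real.exp (1 / τ) ^ U.card := by
              gcongr; exact Real.add_one_le_exp _
          _ = Real.exp (U.card * (1 / τ)) := by rw [Real.exp_nat_mul]
          _ ≤ Real.exp (s * 1) := by
              apply Real.exp_le_exp.mpr
              rw [mul_one_div, div_le_iff₀ hτ0]; linarith
          _ = Real.exp 1 ^ s := by rw [Real.exp_nat_mul]
    _ = K * (Real.exp 1 * τ) ^ s := by rw [mul_pow]; ring

variable [Fintype V]

lemma card_filter_superset_le {ℓ : ℕ} (hℓ : ℓ ≤ Fintype.card V) (U : Finset V) :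
    ((univ.filter (fun S : Finset V => S.card = ℓ ∧ U ⊆ S)).card : ℝ) ≤
      ((Fintype.card V).choose ℓ : ℝ) * ((ℓ : ℝ) / Fintype.card V) ^ U.card := by
  by_cases hU : U.card ≤ ℓ
  · refine le_trans ?_ (choose_sub_sub_le hℓ _ hU)
    have : (univ.filter (fun S : Finset V => S.card = ℓ ∧ U ⊆ S)).card ≤
        (powersetCard (ℓ - U.card) (univ \ U)).card := by
      apply card_le_card_of_injOn (fun S => S \ U)
      · intro S hS
        simp only [Finset.mem_coe, mem_filter, mem_univ, true_and] at hS
        simp only [Finset.mem_coe, mem_powersetCard]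
        exact ⟨sdiff_subset_sdiff (subset_univ _) le_rfl,
          by rw [card_sdiff_of_subset hS.2, hS.1]⟩
      · intro S hS T hT h
        simp only [Finset.mem_coe, mem_filter, mem_univ, true_and] at hS hT
        rw [← sdiff_union_of_subset hS.2, ← sdiff_union_of_subset hT.2]
        exact congrArg (· ∪ U) h
    rw [card_powersetCard, card_sdiff_of_subset (subset_univ _), card_univ] at this
    exact_mod_cast this
  · rw [filter_false_of_mem]
    · simp; positivity
    · rintro S - ⟨h1, h2⟩
      exact hU (h1 ▸ card_le_card h2)

lemma sum_pow_le_of_superset {ℓ : ℕ} (hℓ : ℓ ≤ Fintype.card V) (J : Finset ι)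
    (R : ι → Finset V) {s t : ℕ} (hR : ∀ e ∈ J, (R e).card = s) {B : ℝ} (hB0 : 0 ≤ B)
    (hB : ∀ U : Finset V, U.card ≤ s * t →
      ∑ e ∈ J, ((ℓ : ℝ) / Fintype.card V) ^ (R e \ U).card ≤ B)
    (r : ℕ) (U : Finset V) (hU : U.card + s * r ≤ s * t) :
    ∑ S ∈ univ.filter (fun S : Finset V => S.card = ℓ ∧ U ⊆ S),
        ((J.filter (fun e => R e ⊆ S)).card : ℝ) ^ r ≤
      ((Fintype.card V).choose ℓ : ℝ) * ((ℓ : ℝ) / Fintype.card V) ^ U.card * B ^ r := by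
  induction r generalizing U with
  | zero => simpa using card_filter_superset_le hℓ U
  | succ r ih =>
    set ρ : ℝ := (ℓ : ℝ) / Fintype.card V with hρ
    have hρ0 : 0 ≤ ρ := by positivity
    set N : ℝ := ((Fintype.card V).choose ℓ : ℝ) with hN
    have hU' : U.card ≤ s * t := by omega
    calc ∑ S ∈ univ.filter (fun S : Finset V => S.card = ℓ ∧ U ⊆ S),
          ((J.filter (fun e => R e ⊆ S)).card : ℝ) ^ (r + 1)
        = ∑ S ∈ univ.filter (fun S : Finset V => S.card = ℓ ∧ U ⊆ S), ∑ e ∈ J,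
            if R e ⊆ S then ((J.filter (fun e => R e ⊆ S)).card : ℝ) ^ r else 0 := by
          refine sum_congr rfl fun S _ => ?_
          rw [← sum_filter, sum_const, nsmul_eq_mul, pow_succ']
      _ = ∑ e ∈ J, ∑ S ∈ univ.filter (fun S : Finset V => S.card = ℓ ∧ U ∪ R e ⊆ S),
            ((J.filter (fun e => R e ⊆ S)).card : ℝ) ^ r := by
          rw [sum_comm]
          refine sum_congr rfl fun e _ => ?_
          rw [← sum_filter, filter_filter]
          simp only [union_subset_iff, and_assoc]
      _ ≤ ∑ e ∈ J, N * ρ ^ (U ∪ R e).card * B ^ r := by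
          refine sum_le_sum fun e he => ih _ ?_
          have := card_union_le U (R e)
          rw [hR e he] at this
          rw [mul_add] at hU
          omega
      _ = N * ρ ^ U.card * B ^ r * ∑ e ∈ J, ρ ^ (R e \ U).card := by
          rw [mul_sum]
          refine sum_congr rfl fun e _ => ?_
          rw [← union_sdiff_self_eq_union, card_union_of_disjoint disjoint_sdiff, pow_add]
          ring
      _ ≤ N * ρ ^ U.card * B ^ r * B := by
          gcongr
          exact hB U hU'
      _ = N * ρ ^ U.card * B ^ (r + 1) := by ring

/-- Tail bound for the number of sets `R e` contained in a uniformly random `ℓ`-subset. -/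
lemma card_filter_large_le {ℓ : ℕ} (hℓ : ℓ ≤ Fintype.card V) (J : Finset ι)
    (R : ι → Finset V) {s t : ℕ} (ht : 1 ≤ t) (hR : ∀ e ∈ J, (R e).card = s) {K : ℝ}
    (hK0 : 0 < K)
    (hK : ∀ Q : Finset V, Q.card ≤ s →
      ((J.filter (fun e => Q ⊆ R e)).card : ℝ) *
        ((ℓ : ℝ) / Fintype.card V) ^ (s - Q.card) ≤ K) :
    ((univ.filter (fun S : Finset V => S.card = ℓ ∧
        8 * (K * (Real.exp 1 * t) ^ s) < ((J.filter (fun e => R e ⊆ S)).card : ℝ))).card : ℝ) ≤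
      ((Fintype.card V).choose ℓ : ℝ) * (1 / 8) ^ t := by
  have ht' : (1 : ℝ) ≤ t := by exact_mod_cast ht
  set B : ℝ := K * (Real.exp 1 * t) ^ s with hBdef
  have hB0 : 0 < B := by positivity
  have hB : ∀ U : Finset V, U.card ≤ s * t →
      ∑ e ∈ J, ((ℓ : ℝ) / Fintype.card V) ^ (R e \ U).card ≤ B := fun U hU =>
    sum_pow_card_sdiff_le J R hR (by positivity) ht' hK U (by exact_mod_cast hU)
  have hmom := sum_pow_le_of_superset hℓ J R hR hB0.le hB t ∅ (by simp)
  simp only [empty_subset, and_true, card_empty, pow_zero, mul_one] at hmom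
  set N : ℝ := ((Fintype.card V).choose ℓ : ℝ) with hN
  have key : ((univ.filter (fun S : Finset V => S.card = ℓ ∧
        8 * B < ((J.filter (fun e => R e ⊆ S)).card : ℝ))).card : ℝ) * (8 * B) ^ t ≤
      N * B ^ t := by
    refine le_trans ?_ hmom
    rw [← nsmul_eq_mul, ← sum_const]
    calc _ ≤ ∑ S ∈ univ.filter (fun S : Finset V => S.card = ℓ ∧
              8 * B < ((J.filter (fun e => R e ⊆ S)).card : ℝ)),
              ((J.filter (fun e => R e ⊆ S)).card : ℝ) ^ t := by
          refine sum_le_sum fun S hS => ?_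
          simp only [mem_filter, mem_univ, true_and] at hS
          gcongr
          exact hS.2.le
      _ ≤ _ := by
          refine sum_le_sum_of_subset_of_nonneg ?_ fun _ _ _ => by positivity
          intro S hS
          simp only [mem_filter, mem_univ, true_and] at hS ⊢
          exact hS.1
  rw [mul_pow, ← mul_assoc] at key
  have := le_of_mul_le_mul_right key (by positivity)
  rw [one_div, inv_pow, ← div_eq_mul_inv, le_div_iff₀ (by positivity)]
  exact this

end moment

section butterfly

variable {n p m : ℕ}

/-- The copy `C × {i}` of a set `C ⊆ [n]`. -/
def cloneAt (i : Fin 2) (C : Finset (Fin n)) : Finset (Fin n × Fin 2) :=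
  C.image (fun x => (x, i))

lemma card_cloneAt (i : Fin 2) (C : Finset (Fin n)) : (cloneAt i C).card = C.card :=
  card_image_of_injective _ fun _ _ h => (Prod.ext_iff.mp h).1

/-- The pairs `(j, R)` of a hyperedge index `j` in partition `u` and an `s`-element set
`R ⊆ Ed j`. -/
def edgeParts (π : Fin m → Fin p) (Ed : Fin m → Finset (Fin n)) (u : Fin p) (s : ℕ) :
    Finset (Fin m × Finset (Fin n)) :=
  univ.filter (fun e => π e.1 = u ∧ e.2 ⊆ Ed e.1 ∧ e.2.card = s)

/-- The number of pairs in `edgeParts` whose `i`-th copy is contained in `S`. -/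
noncomputable def partCount (π : Fin m → Fin p) (Ed : Fin m → Finset (Fin n)) (u : Fin p)
    (s : ℕ) (i : Fin 2) (S : Finset (Fin n × Fin 2)) : ℕ :=
  ((edgeParts π Ed u s).filter (fun e => cloneAt i e.2 ⊆ S)).card

lemma card_edges_le_partCount (π : Fin m → Fin p) (Ed : Fin m → Finset (Fin n)) (u : Fin p)
    (s : ℕ) (i : Fin 2) (S : Finset (Fin n × Fin 2)) :
    (univ.filter (fun j => π j = u ∧ (S ∩ cloneAt i (Ed j)).card = s)).card ≤
      partCount π Ed u s i S := by
  apply card_le_card_of_injOn (fun j => (j, (Ed j).filter (fun x => (x, i) ∈ S)))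
  · intro j hj
    simp only [Finset.mem_coe, mem_filter, mem_univ, true_and] at hj
    have he : cloneAt i ((Ed j).filter (fun x => (x, i) ∈ S)) = S ∩ cloneAt i (Ed j) := by
      ext ⟨x, y⟩
      simp only [cloneAt, mem_image, mem_filter, mem_inter, Prod.mk.injEq]
      constructor
      · rintro ⟨z, ⟨h1, h2⟩, rfl, rfl⟩
        exact ⟨h2, z, h1, rfl, rfl⟩
      · rintro ⟨h2, z, h1, rfl, rfl⟩
        exact ⟨z, ⟨h1, h2⟩, rfl, rfl⟩
    simp only [edgeParts, Finset.mem_coe, mem_filter, mem_univ, true_and]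
    refine ⟨⟨hj.1, filter_subset _ _, ?_⟩, ?_⟩
    · rw [← card_cloneAt i, he, hj.2]
    · rw [he]; exact inter_subset_left
  · intro a _ b _ h
    exact (Prod.ext_iff.mp h).1

lemma butterflyDegPart_le (k : ℕ) (π : Fin m → Fin p) (Ed : Fin m → Finset (Fin n))
    (u : Fin p) (S : Finset (Fin n × Fin 2)) :
    butterflyDegPart k n p m π Ed u S ≤
      partCount π Ed u (k / 2) 0 S * partCount π Ed u ((k - 1) / 2) 1 S +
      partCount π Ed u ((k - 1) / 2) 0 S * partCount π Ed u (k / 2) 1 S := by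
  let f : ℕ → Fin 2 → Fin m → ℕ := fun s i j =>
    if π j = u ∧ (S ∩ cloneAt i (Ed j)).card = s then 1 else 0
  have hf : ∀ s i, ∑ j, f s i j ≤ partCount π Ed u s i S := by
    intro s i
    rw [← card_filter]
    exact card_edges_le_partCount π Ed u s i S
  refine le_trans ?_ (add_le_add (Nat.mul_le_mul (hf (k / 2) 0) (hf ((k - 1) / 2) 1))
    (Nat.mul_le_mul (hf ((k - 1) / 2) 0) (hf (k / 2) 1)))
  rw [sum_mul_sum, sum_mul_sum, ← sum_add_distrib, butterflyDegPart]
  refine sum_le_sum fun j _ => ?_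
  rw [← sum_add_distrib]
  refine sum_le_sum fun j' _ => ?_
  split_ifs with h
  · obtain ⟨-, h1, h2⟩ := h
    have e1 : S ∩ (clone1 (Ed j) ∪ clone2 (Ed j')) ∩ clone1 (Ed j) = S ∩ cloneAt 0 (Ed j) := by
      rw [inter_assoc, inter_eq_right.mpr subset_union_left]; rfl
    have e2 : S ∩ (clone1 (Ed j) ∪ clone2 (Ed j')) ∩ clone2 (Ed j') =
        S ∩ cloneAt 1 (Ed j') := by
      rw [inter_assoc, inter_eq_right.mpr subset_union_right]; rfl
    rcases eq_empty_or_nonempty (univ.filter (fun R : Finset (Fin n × Fin 2) =>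
        R.card = k - 1 ∧
        (((R ∩ clone1 (Ed j)).card = k/2 ∧ (R ∩ clone2 (Ed j')).card = (k-1)/2) ∨
         ((R ∩ clone1 (Ed j)).card = (k-1)/2 ∧ (R ∩ clone2 (Ed j')).card = k/2)) ∧
        S ∩ (clone1 (Ed j) ∪ clone2 (Ed j')) = R)) with h0 | ⟨R, hR⟩
    · rw [h0]; simp
    · refine le_trans (b := 1) ?_ ?_
      · refine card_le_one.mpr fun A hA B hB => ?_
        simp only [mem_filter, mem_univ, true_and] at hA hB
        rw [← hA.2.2, ← hB.2.2]
      · simp only [mem_filter, mem_univ, true_and] at hR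
        obtain ⟨-, hc, rfl⟩ := hR
        rw [e1, e2] at hc
        rcases hc with ⟨hc1, hc2⟩ | ⟨hc1, hc2⟩
        · have : f (k / 2) 0 j * f ((k - 1) / 2) 1 j' = 1 := by simp [f, h1, h2, hc1, hc2]
          omega
        · have : f ((k - 1) / 2) 0 j * f (k / 2) 1 j' = 1 := by simp [f, h1, h2, hc1, hc2]
          omega
  · exact Nat.zero_le _

lemma card_edgeParts_superset_le {k : ℕ} (π : Fin m → Fin p) (Ed : Fin m → Finset (Fin n))
    (hEd : ∀ j, (Ed j).card = k - 1) (u : Fin p) (s : ℕ) (Q : Finset (Fin n)) :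
    ((edgeParts π Ed u s).filter (fun e => Q ⊆ e.2)).card ≤
      (univ.filter (fun j => π j = u ∧ Q ⊆ Ed j)).card * 2 ^ (k - 1) := by
  have hsub : (edgeParts π Ed u s).filter (fun e => Q ⊆ e.2) ⊆
      ((univ.filter (fun j => π j = u ∧ Q ⊆ Ed j)).sigma
        (fun j => (Ed j).powerset)).map (Equiv.sigmaEquivProd _ _).toEmbedding := by
    rintro ⟨j, R⟩ h
    simp only [edgeParts, mem_filter, mem_univ, true_and] at h
    simp only [mem_map_equiv, mem_sigma, mem_filter, mem_univ, true_and, mem_powerset]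
    exact ⟨⟨h.1.1, h.2.trans h.1.2.1⟩, h.1.2.1⟩
  refine (card_le_card hsub).trans (le_of_eq ?_)
  rw [card_map, card_sigma, sum_congr rfl fun j _ => by rw [card_powerset, hEd j], sum_const, smul_eq_mul]

lemma card_edgeParts_cloneAt_mul_pow_le {k ℓ : ℕ} {ε : ℝ} (π : Fin m → Fin p)
    (Ed : Fin m → Finset (Fin n)) (hEd : ∀ j, (Ed j).card = k - 1) (hε : 0 < ε)
    (hℓ0 : 0 < ℓ) (hℓ : ℓ ≤ n) (u : Fin p)
    (hreg : ∀ Q : Finset (Fin n), Q.card ≤ k - 1 →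
      ((univ.filter (fun j => π j = u ∧ Q ⊆ Ed j)).card : ℝ)
        ≤ (1/ε^2) * max (((n:ℝ)/(ℓ:ℝ)) ^ ((k:ℝ)/2 - 1 - (Q.card:ℝ))) 1)
    {s : ℕ} (hs : s ≤ k - 1) (hs' : k ≤ 2 * s + 2) (i : Fin 2) (Q : Finset (Fin n × Fin 2))
    (hQ : Q.card ≤ s) :
    (((edgeParts π Ed u s).filter (fun e => Q ⊆ cloneAt i e.2)).card : ℝ) *
      ((ℓ : ℝ) / Fintype.card (Fin n × Fin 2)) ^ (s - Q.card) ≤ 1 / ε ^ 2 * 2 ^ (k - 1) := by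
  rcases eq_empty_or_nonempty ((edgeParts π Ed u s).filter (fun e => Q ⊆ cloneAt i e.2))
    with h0 | ⟨e, he⟩
  · rw [h0]; simp only [card_empty, Nat.cast_zero, zero_mul]; positivity
  have hQe : Q ⊆ cloneAt i e.2 := (mem_filter.mp he).2
  obtain ⟨P, hP, rfl⟩ := subset_image_iff.mp hQe
  change ((cloneAt i P).card : ℕ) ≤ s at hQ
  change (((edgeParts π Ed u s).filter (fun e => cloneAt i P ⊆ cloneAt i e.2)).card : ℝ) *
      _ ^ (s - (cloneAt i P).card) ≤ _
  rw [card_cloneAt] at hQ ⊢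
  have hsubiff : ∀ R : Finset (Fin n), cloneAt i P ⊆ cloneAt i R ↔ P ⊆ R := fun R =>
    image_subset_image_iff fun _ _ h => (Prod.ext_iff.mp h).1
  simp only [hsubiff]
  have h1 : (((edgeParts π Ed u s).filter (fun e => P ⊆ e.2)).card : ℝ) ≤
      ((univ.filter (fun j => π j = u ∧ P ⊆ Ed j)).card : ℝ) * 2 ^ (k - 1) := by
    exact_mod_cast card_edgeParts_superset_le π Ed hEd u s P
  have h2 := hreg P (hQ.trans hs)
  have hℓ' : (0 : ℝ) < ℓ := by exact_mod_cast hℓ0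
  have hn' : (0 : ℝ) < n := by exact_mod_cast hℓ0.trans_le hℓ
  have hx : (1 : ℝ) ≤ n / ℓ := by
    rw [one_le_div hℓ']; exact_mod_cast hℓ
  have h3 : max (((n:ℝ)/(ℓ:ℝ)) ^ ((k:ℝ)/2 - 1 - (P.card:ℝ))) 1 ≤
      ((n : ℝ) / ℓ) ^ (s - P.card) := by
    apply max_le
    · rw [← Real.rpow_natCast]
      apply Real.rpow_le_rpow_of_exponent_le hx
      rw [Nat.cast_sub hQ]
      have : (k : ℝ) ≤ 2 * s + 2 := by exact_mod_cast hs'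
      linarith
    · exact one_le_pow₀ hx
  have h4 : ((ℓ : ℝ) / Fintype.card (Fin n × Fin 2)) ≤ (ℓ : ℝ) / n := by
    simp only [Fintype.card_prod, Fintype.card_fin]
    push_cast
    gcongr
    linarith
  calc _ ≤ (1 / ε ^ 2 * ((n : ℝ) / ℓ) ^ (s - P.card) * 2 ^ (k - 1)) *
        ((ℓ : ℝ) / n) ^ (s - P.card) := by
        gcongr
        refine h1.trans ?_
        gcongr
        refine h2.trans ?_
        gcongr
    _ = 1 / ε ^ 2 * 2 ^ (k - 1) * ((n : ℝ) / ℓ * ((ℓ : ℝ) / n)) ^ (s - P.card) := by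
        rw [mul_pow]; ring
    _ = 1 / ε ^ 2 * 2 ^ (k - 1) := by
        rw [div_mul_div_cancel₀ hℓ'.ne', div_self hn'.ne', one_pow, mul_one]

end butterfly

lemma choose_mul_choose_mul_choose_le {r n ℓ a b : ℕ} (hr : r ≤ n) (hrl : r ≤ ℓ)
    (hab : a + b = r) :
    r.choose a * r.choose b * (2 * n - 2 * r).choose (ℓ - r) ≤ (2 * n).choose ℓ := by
  have h1 : r.choose a * r.choose b ≤ (2 * r).choose r := by
    rw [two_mul, Nat.add_choose_eq r r r]
    exact single_le_sum (f := fun ij : ℕ × ℕ => r.choose ij.1 * r.choose ij.2)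
      (fun _ _ => Nat.zero_le _) (HasAntidiagonal.mem_antidiagonal.mpr hab : (a, b) ∈ _)
  have h2 : (2 * r).choose r * (2 * n - 2 * r).choose (ℓ - r) ≤ (2 * n).choose ℓ := by
    conv_rhs => rw [show 2 * n = 2 * r + (2 * n - 2 * r) by omega, Nat.add_choose_eq]
    exact single_le_sum
      (f := fun ij : ℕ × ℕ => (2 * r).choose ij.1 * (2 * n - 2 * r).choose ij.2)
      (fun _ _ => Nat.zero_le _) (HasAntidiagonal.mem_antidiagonal.mpr (Nat.add_sub_of_le hrl) : (r, ℓ - r) ∈ _)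
  exact (Nat.mul_le_mul_right _ h1).trans h2

lemma kikD_pos {k n ℓ : ℕ} (hk : 2 ≤ k) (hkl : 2 * (k - 1) ≤ ℓ) (hℓ : ℓ ≤ n) :
    0 < kikD k n ℓ := by
  have h1 : 0 < (2 * n - 2 * (k - 1)).choose (ℓ - (k - 1)) := Nat.choose_pos (by omega)
  have h2 : 0 < (k - 1).choose ((k - 1) / 2) := Nat.choose_pos (by omega)
  have h3 : 0 < (k - 1).choose (k / 2) := Nat.choose_pos (by omega)
  have h4 : 0 < (k - 1).choose ((k - 2) / 2) := Nat.choose_pos (by omega)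
  unfold kikD
  split_ifs <;> positivity

lemma kikD_le {k n ℓ : ℕ} (hk : 2 ≤ k) (hkl : 2 * (k - 1) ≤ ℓ) (hℓ : ℓ ≤ n) :
    kikD k n ℓ ≤ 2 * (2 * n).choose ℓ := by
  unfold kikD
  split_ifs with h
  · obtain ⟨r, rfl⟩ := h
    have := choose_mul_choose_mul_choose_le (r := 2 * r + 1 - 1) (n := n) (ℓ := ℓ)
      (a := (2 * r + 1 - 1) / 2) (b := (2 * r + 1 - 1) / 2)
      (by omega) (by omega) (by omega)
    rw [sq]
    omega
  · obtain ⟨r, rfl⟩ := Nat.not_odd_iff_even.mp h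
    have := choose_mul_choose_mul_choose_le (r := r + r - 1) (n := n) (ℓ := ℓ)
      (a := (r + r) / 2) (b := (r + r - 2) / 2)
      (by omega) (by omega) (by omega)
    rw [mul_assoc 2, mul_assoc 2]
    omega

/-- **Bound on bad rows.** There is an absolute constant `c > 0` such
that for every `(ε,ℓ)`-regular `p`-bipartite `k`-uniform hypergraph on `[n]`
(with `2 ≤ k`, `2(k−1) ≤ ℓ ≤ n`, `0 < ε ≤ 1`), setting `N = binom(2n,ℓ)`, `D` the
Kikuchi constant, and `Δ = c^{k−1}·ε^{−4}·(ln(32pN/(ε²D)))^{2(k−1)}`, the number of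
`ℓ`-element subsets `S` of `[n] × {1,2}` with `γ_u(S) > Δ` for some `u ∈ [p]` is at
most `ε²D/16`. -/
theorem bound_on_bad_rows :
    ∃ c : ℝ, 0 < c ∧
      ∀ (k n p m ℓ : ℕ) (ε : ℝ)
        (π : Fin m → Fin p) (Ed : Fin m → Finset (Fin n)),
        2 ≤ k → 2*(k-1) ≤ ℓ → ℓ ≤ n → 0 < ε → ε ≤ 1 →
        (∀ j, (Ed j).card = k - 1) →
        -- (ε,ℓ)-regularity
        (∀ (u : Fin p) (Q : Finset (Fin n)), Q.card ≤ k - 1 →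
          ((Finset.univ.filter (fun j => π j = u ∧ Q ⊆ Ed j)).card : ℝ)
            ≤ (1/ε^2) * max (((n:ℝ)/(ℓ:ℝ)) ^ ((k:ℝ)/2 - 1 - (Q.card:ℝ))) 1) →
        (((ellSubsets n ℓ).filter (fun S => ∃ u : Fin p,
            (c^(k-1) * (1/ε^4) *
              (Real.log ((32 * (p:ℝ) * ((2*n).choose ℓ : ℝ)) / (ε^2 * (kikD k n ℓ : ℝ))))^(2*(k-1)))
              < (butterflyDegPart k n p m π Ed u S : ℝ))).card : ℝ)
          ≤ ε^2 * (kikD k n ℓ : ℝ) / 16 := by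
  refine ⟨3072, by norm_num, ?_⟩
  intro k n p m ℓ ε π Ed hk hkl hℓ hε hε1 hEd hreg
  have hD0 : (0 : ℝ) < kikD k n ℓ := by exact_mod_cast kikD_pos hk hkl hℓ
  have hDN : (kikD k n ℓ : ℝ) ≤ 2 * ((2 * n).choose ℓ : ℝ) := by
    exact_mod_cast kikD_le hk hkl hℓ
  set N : ℝ := ((2 * n).choose ℓ : ℝ) with hN
  set D : ℝ := (kikD k n ℓ : ℝ) with hD
  have hN0 : 0 < N := by linarith
  have hcard : Fintype.card (Fin n × Fin 2) = 2 * n := by simp [mul_comm]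
  rcases Nat.eq_zero_or_pos p with rfl | hp
  · rw [filter_false_of_mem]
    · simp; positivity
    · rintro S - ⟨u, -⟩
      exact u.elim0
  have hp1 : (1 : ℝ) ≤ p := by exact_mod_cast hp
  set A : ℝ := 32 * (p : ℝ) * N / (ε ^ 2 * D) with hA
  set L : ℝ := Real.log A with hL
  have hεD : ε ^ 2 * D ≤ 2 * N := by
    have : ε ^ 2 ≤ 1 := pow_le_one₀ hε.le hε1
    nlinarith
  have hA16 : 16 ≤ A := by
    rw [hA, le_div_iff₀ (by positivity)]
    nlinarith
  have hL1 : 1 ≤ L := by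
    rw [hL, Real.le_log_iff_exp_le (by linarith)]
    have := Real.exp_one_lt_d9
    linarith
  set t : ℕ := ⌈L⌉₊ with ht
  have htL : L ≤ t := Nat.le_ceil L
  have ht2L : (t : ℝ) ≤ 2 * L := by
    have := Nat.ceil_lt_add_one (a := L) (by linarith)
    linarith
  have ht1 : 1 ≤ t := by exact_mod_cast hL1.trans htL
  set K : ℝ := 1 / ε ^ 2 * 2 ^ (k - 1) with hKdef
  have hK0 : 0 < K := by positivity
  set bad : Fin p → ℕ → Fin 2 → Finset (Finset (Fin n × Fin 2)) := fun u s i =>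
    univ.filter (fun S => S.card = ℓ ∧
      8 * (K * (Real.exp 1 * t) ^ s) < (partCount π Ed u s i S : ℝ)) with hbad
  have hbadcard : ∀ u s i, s ≤ k - 1 → k ≤ 2 * s + 2 →
      ((bad u s i).card : ℝ) ≤ N * (1 / 8) ^ t := by
    intro u s i hs hs'
    have := card_filter_large_le (ℓ := ℓ) (by omega) (edgeParts π Ed u s)
      (fun e => cloneAt i e.2) ht1 (s := s) (fun e he => by
        rw [card_cloneAt]; exact (mem_filter.mp he).2.2.2) hK0
      (card_edgeParts_cloneAt_mul_pow_le π Ed hEd hε (by omega) hℓ u (hreg u) hs hs' i)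
    rwa [hcard] at this
  have hgood : ∀ u (S : Finset (Fin n × Fin 2)), S.card = ℓ →
      S ∉ bad u (k / 2) 0 → S ∉ bad u ((k - 1) / 2) 1 →
      S ∉ bad u ((k - 1) / 2) 0 → S ∉ bad u (k / 2) 1 →
      (butterflyDegPart k n p m π Ed u S : ℝ) ≤
        3072 ^ (k - 1) * (1 / ε ^ 4) * L ^ (2 * (k - 1)) := by
    intro u S hS h1 h2 h3 h4
    simp only [hbad, mem_filter, mem_univ, true_and, hS, not_lt] at h1 h2 h3 h4
    have hb : (butterflyDegPart k n p m π Ed u S : ℝ) ≤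
        (partCount π Ed u (k / 2) 0 S : ℝ) * partCount π Ed u ((k - 1) / 2) 1 S +
        (partCount π Ed u ((k - 1) / 2) 0 S : ℝ) * partCount π Ed u (k / 2) 1 S := by
      exact_mod_cast butterflyDegPart_le k π Ed u S
    have hsum : k / 2 + (k - 1) / 2 = k - 1 := by omega
    have he : Real.exp 1 ≤ 3 := by
      have := Real.exp_one_lt_d9
      linarith
    calc (butterflyDegPart k n p m π Ed u S : ℝ)
        ≤ 8 * (K * (Real.exp 1 * t) ^ (k / 2)) * (8 * (K * (Real.exp 1 * t) ^ ((k - 1) / 2))) +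
          8 * (K * (Real.exp 1 * t) ^ ((k - 1) / 2)) * (8 * (K * (Real.exp 1 * t) ^ (k / 2))) := by
          refine hb.trans ?_
          gcongr
      _ = 128 * K ^ 2 * (Real.exp 1 * t) ^ (k / 2 + (k - 1) / 2) := by rw [pow_add]; ring
      _ ≤ 128 * K ^ 2 * (3 * (2 * L)) ^ (k - 1) := by
          rw [hsum]
          gcongr
      _ = 128 * (1 / ε ^ 4) * (24 ^ (k - 1) * L ^ (k - 1)) := by
          have : (24 : ℝ) ^ (k - 1) = (2 ^ (k - 1)) ^ 2 * 6 ^ (k - 1) := by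
            rw [← pow_mul, mul_comm (k - 1) 2, pow_mul, ← mul_pow]; norm_num
          rw [this, hKdef, ← mul_assoc 3 2 L, mul_pow (3 * 2) L]
          norm_num
          ring
      _ ≤ 128 ^ (k - 1) * (1 / ε ^ 4) * (24 ^ (k - 1) * L ^ (2 * (k - 1))) := by
          gcongr
          · exact le_self_pow₀ (by norm_num) (by omega)
          · omega
      _ = 3072 ^ (k - 1) * (1 / ε ^ 4) * L ^ (2 * (k - 1)) := by
          rw [show (3072 : ℝ) = 128 * 24 by norm_num, mul_pow]; ring
  have hsub : (ellSubsets n ℓ).filter (fun S => ∃ u : Fin p,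
      3072 ^ (k - 1) * (1 / ε ^ 4) * L ^ (2 * (k - 1)) <
        (butterflyDegPart k n p m π Ed u S : ℝ)) ⊆
      univ.biUnion (fun u : Fin p => (bad u (k / 2) 0 ∪ bad u ((k - 1) / 2) 1) ∪
        (bad u ((k - 1) / 2) 0 ∪ bad u (k / 2) 1)) := by
    intro S hS
    simp only [ellSubsets, mem_filter, mem_univ, true_and] at hS
    obtain ⟨hSc, u, hu⟩ := hS
    rw [mem_biUnion]
    refine ⟨u, mem_univ _, ?_⟩
    by_contra hcon
    simp only [mem_union, not_or] at hcon
    exact absurd (hgood u S hSc hcon.1.1 hcon.1.2 hcon.2.1 hcon.2.2) (not_le.mpr hu)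
  have hunion : ∀ u : Fin p, (((bad u (k / 2) 0 ∪ bad u ((k - 1) / 2) 1) ∪
        (bad u ((k - 1) / 2) 0 ∪ bad u (k / 2) 1)).card : ℝ) ≤ 4 * (N * (1 / 8) ^ t) := by
    intro u
    have e1 := hbadcard u (k / 2) 0 (by omega) (by omega)
    have e2 := hbadcard u ((k - 1) / 2) 1 (by omega) (by omega)
    have e3 := hbadcard u ((k - 1) / 2) 0 (by omega) (by omega)
    have e4 := hbadcard u (k / 2) 1 (by omega) (by omega)
    have hc : (((bad u (k / 2) 0 ∪ bad u ((k - 1) / 2) 1) ∪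
        (bad u ((k - 1) / 2) 0 ∪ bad u (k / 2) 1)).card : ℝ) ≤
        ((bad u (k / 2) 0).card + (bad u ((k - 1) / 2) 1).card) +
        ((bad u ((k - 1) / 2) 0).card + (bad u (k / 2) 1).card) := by
      exact_mod_cast (card_union_le _ _).trans
        (add_le_add (card_union_le _ _) (card_union_le _ _))
    linarith
  have htail : (1 / 8 : ℝ) ^ t ≤ 1 / 2 * (1 / A) := by
    have h8 : (1 / 8 : ℝ) ^ t = (1 / 2) ^ t * (1 / 4) ^ t := by
      rw [← mul_pow]; norm_num
    have h2 : (1 / 2 : ℝ) ^ t ≤ 1 / 2 :=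
      pow_le_of_le_one (by norm_num) (by norm_num) (by omega)
    have h4 : (1 / 4 : ℝ) ^ t ≤ 1 / A := by
      rw [one_div, inv_pow, one_div]
      apply inv_anti₀ (by linarith)
      calc A = Real.exp L := (Real.exp_log (by linarith)).symm
        _ ≤ Real.exp t := Real.exp_le_exp.mpr htL
        _ = Real.exp 1 ^ t := by rw [← Real.exp_nat_mul, mul_one]
        _ ≤ 4 ^ t := by
            have := Real.exp_one_lt_d9
            gcongr
            linarith
    rw [h8]
    gcongr
  calc _ ≤ ((univ.biUnion (fun u : Fin p => (bad u (k / 2) 0 ∪ bad u ((k - 1) / 2) 1) ∪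
        (bad u ((k - 1) / 2) 0 ∪ bad u (k / 2) 1))).card : ℝ) := by
        exact_mod_cast card_le_card hsub
    _ ≤ ∑ u : Fin p, (((bad u (k / 2) 0 ∪ bad u ((k - 1) / 2) 1) ∪
        (bad u ((k - 1) / 2) 0 ∪ bad u (k / 2) 1)).card : ℝ) := by
        exact_mod_cast card_biUnion_le
    _ ≤ ∑ _u : Fin p, 4 * (N * (1 / 8) ^ t) := sum_le_sum fun u _ => hunion u
    _ = p * (4 * (N * (1 / 8) ^ t)) := by simp
    _ ≤ p * (4 * (N * (1 / 2 * (1 / A)))) := by gcongr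
    _ = ε ^ 2 * D / 16 := by
        rw [hA]
        field_simp
        norm_num
end

section
/- There is an absolute constant c > 0 such that the following holds. Let H be a k-uniform hypergraph on [n] with m hyperedges, let E₁,…,E_r ⊆ H be pairwise disjoint even covers in H, and let (b_C)_{C∈H} be independent uniformly random ±1 signs. Then with probability at least 1 − e^{−c·r} over the draw of (b_C), every x ∈ {−1,1}^n satisfies ∏_{i∈C} x_i ≠ b_C for at least r/3 hyperedges C ∈ H; equivalently, the value of the k-XOR instance (the maximum over x ∈ {−1,1}^n of the fraction of C ∈ H with ∏_{i∈C} x_i = b_C) is at most 1 − r/(3m). -/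
open Finset
open scoped Classical

/-- The real sign encoded by a Boolean: `true ↦ 1`, `false ↦ -1`. -/
noncomputable def boolSign (b : Bool) : ℝ := if b then 1 else -1

/-- The product of the signs `b a` over `a ∈ A`. -/
noncomputable def signProd {α : Type*} (A : Finset α) (b : α → Bool) : ℝ :=
  ∏ a ∈ A, boolSign (b a)

lemma signProd_eq_one_or {α : Type*} (A : Finset α) (b : α → Bool) :
    signProd A b = 1 ∨ signProd A b = -1 := by
  unfold signProd
  induction A using Finset.induction_on with
  | empty => simp
  | insert a s ha ih =>
    rw [Finset.prod_insert ha]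
    rcases ih with h | h <;> rw [h] <;> cases b a <;> simp [boolSign]

lemma signProd_update_of_notMem {α : Type*} [DecidableEq α] {A : Finset α} {a : α} (ha : a ∉ A)
    (b : α → Bool) (v : Bool) : signProd A (Function.update b a v) = signProd A b := by
  unfold signProd
  refine Finset.prod_congr rfl fun c hc => ?_
  rw [Function.update_of_ne (by rintro rfl; exact ha hc)]

lemma signProd_update_not {α : Type*} [DecidableEq α] {A : Finset α} {a : α} (ha : a ∈ A) (b : α → Bool) :
    signProd A (Function.update b a (!b a)) = -signProd A b := by
  unfold signProd
  rw [← Finset.mul_prod_erase A _ ha, ← Finset.mul_prod_erase A (fun c => boolSign (b c)) ha,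
    ← neg_mul]
  congr 1
  · cases h : b a <;> simp [boolSign]
  · refine Finset.prod_congr rfl fun c hc => ?_
    rw [Function.update_of_ne (Finset.ne_of_mem_erase hc)]

/-- The sign products over disjoint nonempty sets are independent: the mean of
`∏ i ∈ S, (3 + signProd (A i) b) / 4` is `(3 / 4) ^ #S`. -/
lemma sum_prod_signProd {α ι : Type*} [Fintype α] [DecidableEq α] (A : ι → Finset α)
    (hne : ∀ i, (A i).Nonempty) (hdisj : ∀ i j, i ≠ j → Disjoint (A i) (A j)) (S : Finset ι) :
    ∑ b : α → Bool, ∏ i ∈ S, (3 + signProd (A i) b) / 4 =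
      (3 / 4 : ℝ) ^ #S * Fintype.card (α → Bool) := by
  induction S using Finset.induction_on with
  | empty => simp
  | insert j S hj ih =>
    obtain ⟨a, ha⟩ := hne j
    have hinv : Function.Involutive (fun b : α → Bool => Function.update b a (!b a)) := by
      intro b
      simp
    have hS : ∀ i ∈ S, a ∉ A i := fun i hi hai =>
      Finset.disjoint_left.mp (hdisj i j (by rintro rfl; exact hj hi)) hai ha
    set flip : Equiv.Perm (α → Bool) := hinv.toPerm
    have hflip_apply : ∀ b, flip b = Function.update b a (!b a) := fun _ => rfl
    have key := Equiv.sum_comp flip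
      (fun b : α → Bool => ∏ i ∈ insert j S, (3 + signProd (A i) b) / 4)
    have hflip : ∀ b : α → Bool,
        ∏ i ∈ insert j S, (3 + signProd (A i) (flip b)) / 4 =
          (3 - signProd (A j) b) / 4 * ∏ i ∈ S, (3 + signProd (A i) b) / 4 := by
      intro b
      rw [Finset.prod_insert hj]
      congr 1
      · rw [hflip_apply, signProd_update_not ha]
        ring
      · refine Finset.prod_congr rfl fun i hi => ?_
        rw [hflip_apply, signProd_update_of_notMem (hS i hi)]
    have hsum : ∑ b : α → Bool, ∏ i ∈ insert j S, (3 + signProd (A i) (flip b)) / 4 +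
        ∑ b : α → Bool, ∏ i ∈ insert j S, (3 + signProd (A i) b) / 4 =
          3 / 2 * ∑ b : α → Bool, ∏ i ∈ S, (3 + signProd (A i) b) / 4 := by
      rw [← Finset.sum_add_distrib, Finset.mul_sum]
      refine Finset.sum_congr rfl fun b _ => ?_
      rw [hflip, Finset.prod_insert hj]
      ring
    rw [key, ih] at hsum
    rw [Finset.card_insert_of_notMem hj, pow_succ]
    linarith

/-- Chernoff bound: few sign vectors make fewer than a third of the sign products negative. -/
lemma card_few_negative_signProd_le {α : Type*} [Fintype α] [DecidableEq α] {r : ℕ} (A : Fin r → Finset α)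
    (hne : ∀ i, (A i).Nonempty) (hdisj : ∀ i j, i ≠ j → Disjoint (A i) (A j)) :
    (#{b : α → Bool | (#{i | signProd (A i) b = -1} : ℝ) < r / 3} : ℝ) ≤
      Real.exp (-(Real.log (4 / 3) - Real.log 2 / 3) * r) * Fintype.card (α → Bool) := by
  have hsum := sum_prod_signProd A hne hdisj Finset.univ
  rw [Finset.card_univ, Fintype.card_fin] at hsum
  have hweight : ∀ b : α → Bool, ∏ i, (3 + signProd (A i) b) / 4 =
      (1 / 2 : ℝ) ^ #{i | signProd (A i) b = -1} := by
    intro b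
    rw [← Finset.prod_const, Finset.prod_filter]
    refine Finset.prod_congr rfl fun i _ => ?_
    rcases signProd_eq_one_or (A i) b with h | h <;> rw [h] <;> norm_num
  have hhalf : ∀ y : ℝ, (1 / 2 : ℝ) ^ y = Real.exp (-(Real.log 2 * y)) := by
    intro y
    rw [Real.rpow_def_of_pos (by norm_num), one_div, Real.log_inv, neg_mul]
  have hmarkov : (#{b : α → Bool | (#{i | signProd (A i) b = -1} : ℝ) < r / 3} : ℝ) *
      Real.exp (-(Real.log 2 * (r / 3))) ≤ (3 / 4 : ℝ) ^ r * Fintype.card (α → Bool) := by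
    rw [← hsum, ← nsmul_eq_mul, ← Finset.sum_const]
    refine (Finset.sum_le_sum fun b hb => ?_).trans
      (Finset.sum_le_sum_of_subset_of_nonneg (Finset.filter_subset _ _) fun b _ _ => ?_)
    · rw [hweight, ← hhalf, ← Real.rpow_natCast]
      exact Real.rpow_le_rpow_of_exponent_ge (by norm_num) (by norm_num)
        (Finset.mem_filter.mp hb).2.le
    · rw [hweight]
      positivity
  have hpow : (3 / 4 : ℝ) ^ r = Real.exp (-(Real.log (4 / 3) * r)) := by
    rw [← Real.rpow_natCast, Real.rpow_def_of_pos (by norm_num),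
      show (3 / 4 : ℝ) = (4 / 3)⁻¹ by norm_num, Real.log_inv, neg_mul]
  rw [hpow] at hmarkov
  have hmul := mul_le_mul_of_nonneg_right hmarkov (Real.exp_pos (Real.log 2 * (r / 3))).le
  rw [mul_assoc, ← Real.exp_add, neg_add_cancel, Real.exp_zero, mul_one] at hmul
  refine hmul.trans_eq ?_
  rw [mul_right_comm, ← Real.exp_add]
  congr 2
  ring

/-- Multiplying the monomials of an even cover gives `1` at every sign vector. -/
lemma prod_prod_eq_one_of_even {V : Type*} [Fintype V] [DecidableEq V] (E : Finset (Finset V))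
    (hE : ∀ v, Even #{C ∈ E | v ∈ C}) (x : V → ℝ) (hx : ∀ i, x i = 1 ∨ x i = -1) :
    ∏ C ∈ E, ∏ v ∈ C, x v = 1 := by
  have hind : ∀ C ∈ E, ∏ v ∈ C, x v = ∏ v, if v ∈ C then x v else 1 := fun C _ => by simp
  rw [Finset.prod_congr rfl hind, Finset.prod_comm]
  refine Finset.prod_eq_one fun v _ => ?_
  rw [← Finset.prod_filter, Finset.prod_const]
  rcases hx v with h | h <;> rw [h]
  · exact one_pow _
  · exact (hE v).neg_one_pow

/-- Each even cover with negative sign product contains a violated constraint. -/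
lemma card_negative_signProd_le_card_violated {V : Type*} [Fintype V] [DecidableEq V] {r : ℕ}
    (H : Finset (Finset V)) (E : Fin r → Finset (Finset V)) (hsub : ∀ i, E i ⊆ H)
    (heven : ∀ i v, Even #{C ∈ E i | v ∈ C})
    (hdisj : ∀ i j, i ≠ j → Disjoint (E i) (E j)) (b : {C // C ∈ H} → Bool)
    (x : V → ℝ) (hx : ∀ i, x i = 1 ∨ x i = -1) :
    #{i | signProd ((E i).subtype (· ∈ H)) b = -1} ≤
      #{C ∈ H.attach | ∏ i ∈ C.1, x i ≠ if b C then (1 : ℝ) else -1} := by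
  have hex : ∀ i, signProd ((E i).subtype (· ∈ H)) b = -1 →
      ∃ C : {C // C ∈ H}, C.1 ∈ E i ∧ ∏ v ∈ C.1, x v ≠ if b C then (1 : ℝ) else -1 := by
    intro i hi
    by_contra! hcon
    have hprod : signProd ((E i).subtype (· ∈ H)) b = 1 := by
      rw [← prod_prod_eq_one_of_even (E i) (heven i) x hx,
        ← Finset.prod_subtype_of_mem (fun C => ∏ v ∈ C, x v) (hsub i)]
      exact Finset.prod_congr rfl fun C hC => (hcon C (Finset.mem_subtype.mp hC)).symm
    rw [hprod] at hi
    norm_num at hi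
  refine Finset.card_le_card_of_forall_subsingleton (fun i C => C.1 ∈ E i) (fun i hi => ?_)
    (fun C _ i hi j hj => ?_)
  · obtain ⟨C, hCE, hC⟩ := hex i (Finset.mem_filter.mp hi).2
    exact ⟨C, Finset.mem_filter.mpr ⟨Finset.mem_attach _ _, hC⟩, hCE⟩
  · by_contra hne
    exact Finset.disjoint_left.mp (hdisj i j hne) hi.2 hj.2

/-- **Ideal FKO witnesses refute k-XOR.** There is an absolute constant
`c > 0` such that: if `H` is a `k`-uniform hypergraph on `[n]` and `E₁,…,E_r ⊆ H` are
pairwise disjoint (nonempty) even covers in `H`, then for at least a `1 − e^{−c·r}`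
fraction of all sign assignments `b : H → {−1,1}` (encoded by Boolean functions,
`true ↦ 1`, `false ↦ −1`), every `x ∈ {−1,1}^n` violates (`∏_{i∈C} x_i ≠ b_C`) at least
`r/3` of the constraints; equivalently, the fraction of satisfied constraints is at most
`1 − r/(3m)` where `m = |H|`. -/
theorem ideal_fko_witness_refutes :
    ∃ c : ℝ, 0 < c ∧
      ∀ (k n r : ℕ) (H : Finset (Finset (Fin n)))
        (E : Fin r → Finset (Finset (Fin n))),
        (∀ C ∈ H, C.card = k) →
        (∀ i, E i ⊆ H ∧ (E i).Nonempty ∧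
          ∀ v : Fin n, Even (((E i).filter (fun C => v ∈ C)).card)) →
        (∀ i j, i ≠ j → Disjoint (E i) (E j)) →
        (1 - Real.exp (-c * r)) * (Fintype.card ({C // C ∈ H} → Bool) : ℝ) ≤
          ((Finset.univ.filter (fun b : {C // C ∈ H} → Bool =>
            ∀ x : Fin n → ℝ, (∀ i, x i = 1 ∨ x i = -1) →
              ((r:ℝ)/3 ≤
                ((H.attach.filter (fun C =>
                    (∏ i ∈ C.1, x i) ≠ (if b C then (1:ℝ) else -1))).card : ℝ)) ∧
              (((H.attach.filter (fun C =>
                    (∏ i ∈ C.1, x i) = (if b C then (1:ℝ) else -1))).card : ℝ)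
                ≤ (1 - (r:ℝ)/(3*(H.card:ℝ))) * (H.card : ℝ)))).card : ℝ) := by
  refine ⟨Real.log (4 / 3) - Real.log 2 / 3, ?_, ?_⟩
  · have h : Real.log 2 < 3 * Real.log (4 / 3) := by
      rw [← Real.log_rpow (by norm_num)]
      exact Real.log_lt_log (by norm_num) (by norm_num)
    linarith
  intro k n r H E _ hE hdisj
  set A : Fin r → Finset {C // C ∈ H} := fun i => (E i).subtype (· ∈ H)
  have hAne : ∀ i, (A i).Nonempty := by
    intro i
    obtain ⟨C, hC⟩ := (hE i).2.1
    exact ⟨⟨C, (hE i).1 hC⟩, Finset.mem_subtype.mpr hC⟩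
  have hAdisj : ∀ i j, i ≠ j → Disjoint (A i) (A j) := by
    intro i j hij
    rw [Finset.disjoint_left]
    intro C hi hj
    exact Finset.disjoint_left.mp (hdisj i j hij)
      (Finset.mem_subtype.mp hi) (Finset.mem_subtype.mp hj)
  have hbad := card_few_negative_signProd_le A hAne hAdisj
  have hsplit := Finset.card_filter_add_card_filter_not (s := Finset.univ)
    (fun b : {C // C ∈ H} → Bool => (#{i | signProd (A i) b = -1} : ℝ) < r / 3)
  rw [Finset.card_univ] at hsplit
  have hsplit' := congrArg (Nat.cast : ℕ → ℝ) hsplit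
  rw [Nat.cast_add] at hsplit'
  refine le_trans (b := (#{b : {C // C ∈ H} → Bool |
    ¬ (#{i | signProd (A i) b = -1} : ℝ) < r / 3} : ℝ)) (by linarith) ?_
  refine Nat.cast_le.mpr (Finset.card_le_card fun b hb => ?_)
  have hb' := not_lt.mp (Finset.mem_filter.mp hb).2
  refine Finset.mem_filter.mpr ⟨Finset.mem_univ _, fun x hx => ?_⟩
  have hviol : (r : ℝ) / 3 ≤
      (#{C ∈ H.attach | ∏ i ∈ C.1, x i ≠ if b C then (1 : ℝ) else -1} : ℝ) := by
    refine hb'.trans (Nat.cast_le.mpr ?_)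
    exact card_negative_signProd_le_card_violated H E (fun i => (hE i).1)
      (fun i v => by convert (hE i).2.2 v) hdisj b x hx
  refine ⟨hviol, ?_⟩
  have hcount := congrArg (Nat.cast : ℕ → ℝ)
    (Finset.card_filter_add_card_filter_not (s := H.attach)
      (fun C => ∏ i ∈ C.1, x i = if b C then (1 : ℝ) else -1))
  rw [Nat.cast_add, Finset.card_attach] at hcount
  have hvalue : (1 - (r : ℝ) / (3 * #H)) * #H = #H - r / 3 := by
    rcases H.eq_empty_or_nonempty with rfl | hH
    · have hr : r = 0 := by
        by_contra hr
        obtain ⟨C, hC⟩ := (hE ⟨0, Nat.pos_of_ne_zero hr⟩).2.1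
        exact absurd ((hE _).1 hC) (Finset.notMem_empty C)
      simp [hr]
    · have : (#H : ℝ) ≠ 0 := Nat.cast_ne_zero.mpr hH.card_pos.ne'
      field_simp
  rw [hvalue]
  linarith
end

section
/- There exist absolute constants Γ > 0 and c > 0 such that for every k ≥ 2 and all integers n, ℓ with 2(k−1) ≤ ℓ ≤ n the following holds. Set m₀ := Γ^k · n · (n/ℓ)^{k/2 − 1} · (log₂ n)^{4k+1} and h := c·ℓ·log₂ n. Every k-uniform hypergraph on [n] with m ≥ 2·m₀ hyperedges contains at least ⌊m₀/h⌋ pairwise hyperedge-disjoint even covers, each of length at most h. -/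
open Finset

/-- `E` is an even cover in the hypergraph `H` on vertex set `Fin n`: a nonempty
collection of distinct hyperedges of `H` such that every vertex lies in an even
number of them. -/
def IsEvenCover {n : ℕ} (H E : Finset (Finset (Fin n))) : Prop :=
  E ⊆ H ∧ E.Nonempty ∧ ∀ v : Fin n, Even ((E.filter (fun C => v ∈ C)).card)

open Classical in
/-- Sparsity of locally bounded graphs on a family of vectors: if for every coordinate `c` each
vertex has at most `t` neighbours differing from it at `c`, then the graph has few edges. -/
theorem sum_card_related_le {ι α : Type*} (F : (ι → α) → (ι → α) → Prop)
    (hsymm : ∀ x y, F x y → F y x) (hirr : ∀ x, ¬ F x x) (t : ℕ) (A : Finset (ι → α))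
    (hA : ∀ x ∈ A, ∀ c, #{y ∈ A | F x y ∧ y c ≠ x c} ≤ t) :
    ∑ x ∈ A, #{y ∈ A | F x y} ≤ 2 * t * (#A * Nat.log 2 #A) := by
  induction A using Finset.strongInduction with
  | H A ih =>
    rcases Nat.lt_or_ge 1 #A with h1 | h1
    · obtain ⟨x, hx, y, hy, hxy⟩ := Finset.one_lt_card.1 h1
      obtain ⟨c, hc⟩ := Function.ne_iff.1 hxy
      set A₀ := {z ∈ A | z c = x c} with hA₀
      set A₁ := {z ∈ A | ¬ z c = x c} with hA₁
      have hsub₀ : A₀ ⊂ A := Finset.filter_ssubset.2 ⟨y, hy, fun h => hc h.symm⟩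
      have hsub₁ : A₁ ⊂ A := Finset.filter_ssubset.2 ⟨x, hx, fun h => h rfl⟩
      have hmono : ∀ B ⊂ A, ∀ x ∈ B, ∀ c, #{y ∈ B | F x y ∧ y c ≠ x c} ≤ t := fun B hB x hx c =>
        (Finset.card_le_card (Finset.filter_subset_filter _ hB.1)).trans (hA x (hB.1 hx) c)
      have ih₀ := ih A₀ hsub₀ (hmono _ hsub₀)
      have ih₁ := ih A₁ hsub₁ (hmono _ hsub₁)
      have hcard : #A₀ + #A₁ = #A := Finset.card_filter_add_card_filter_not _
      have hpos₀ : 0 < #A₀ := Finset.card_pos.2 ⟨x, by simp [hA₀, hx]⟩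
      have hpos₁ : 0 < #A₁ := Finset.card_pos.2 ⟨y, by simp [hA₁, hy, Ne.symm hc]⟩
      have hsplit : ∀ z, #{w ∈ A | F z w} = #{w ∈ A₀ | F z w} + #{w ∈ A₁ | F z w} := by
        intro z
        rw [← Finset.card_filter_add_card_filter_not (s := {w ∈ A | F z w}) (fun w => w c = x c),
          hA₀, hA₁, Finset.filter_comm, Finset.filter_comm (fun w => F z w)]
      have hsum : ∑ z ∈ A, #{w ∈ A | F z w} =
          ∑ z ∈ A₀, #{w ∈ A₀ | F z w} + ∑ z ∈ A₁, #{w ∈ A₁ | F z w} +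
          (∑ z ∈ A₀, #{w ∈ A₁ | F z w} + ∑ z ∈ A₁, #{w ∈ A₀ | F z w}) := by
        rw [← Finset.sum_filter_add_sum_filter_not A (fun w => w c = x c)]
        simp only [hsplit, Finset.sum_add_distrib, ← hA₀, ← hA₁]
        ring
      have hcomm : ∑ z ∈ A₀, #{w ∈ A₁ | F z w} = ∑ z ∈ A₁, #{w ∈ A₀ | F z w} := by
        simp only [Finset.card_filter]
        rw [Finset.sum_comm]
        refine Finset.sum_congr rfl fun z _ => Finset.sum_congr rfl fun w _ => ?_
        simp only [show F w z ↔ F z w from ⟨hsymm _ _, hsymm _ _⟩]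
      have hc₀ : ∑ z ∈ A₀, #{w ∈ A₁ | F z w} ≤ #A₀ * t := by
        refine Finset.sum_le_card_nsmul _ _ _ fun z hz => ?_
        refine le_trans (Finset.card_le_card fun w hw => ?_) (hA z (hsub₀.1 hz) c)
        simp only [hA₀, hA₁, Finset.mem_filter] at hz hw ⊢
        exact ⟨hw.1.1, hw.2, by rw [hz.2]; exact hw.1.2⟩
      have hc₁ : ∑ z ∈ A₁, #{w ∈ A₀ | F z w} ≤ #A₁ * t := by
        refine Finset.sum_le_card_nsmul _ _ _ fun z hz => ?_
        refine le_trans (Finset.card_le_card fun w hw => ?_) (hA z (hsub₁.1 hz) c)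
        simp only [hA₀, hA₁, Finset.mem_filter] at hz hw ⊢
        exact ⟨hw.1.1, hw.2, by rw [hw.1.2]; exact Ne.symm hz.2⟩
      have hlog : ∀ a b : ℕ, 0 < a → a ≤ b →
          a * Nat.log 2 a + b * Nat.log 2 b + a ≤ (a + b) * Nat.log 2 (a + b) := by
        intro a b ha hab
        have e1 : Nat.log 2 a + 1 ≤ Nat.log 2 (a + b) := by
          rw [← Nat.log_mul_base one_lt_two ha.ne']
          exact Nat.log_mono_right (by omega)
        have e2 : Nat.log 2 b ≤ Nat.log 2 (a + b) := Nat.log_mono_right (by omega)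
        nlinarith [Nat.mul_le_mul_left a e1, Nat.mul_le_mul_left b e2]
      rw [hsum, ← hcard]
      rcases le_total #A₀ #A₁ with h | h
      · have := Nat.mul_le_mul_left (2 * t) (hlog _ _ hpos₀ h)
        nlinarith
      · have := Nat.mul_le_mul_left (2 * t) (hlog _ _ hpos₁ h)
        rw [add_comm #A₁ #A₀] at this
        nlinarith
    · have : ∀ x ∈ A, #{y ∈ A | F x y} = 0 := by
        intro x hx
        rw [Finset.card_eq_zero, Finset.filter_eq_empty_iff]
        intro y hy hF
        rw [Finset.card_le_one.1 h1 x hx y hy] at hF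
        exact hirr _ hF
      rw [Finset.sum_eq_zero this]
      exact Nat.zero_le _

/-- A graph given by its darts `(v, x)`, running from `v` to `v + φ x`, has a nonempty set of
vertices inducing a subgraph of minimum degree at least `δ` as soon as its average degree
exceeds `2 * δ`. -/
theorem exists_induced_minDegree {V W : Type*} [AddCommGroup V] [Fintype W]
    [DecidableEq V] [DecidableEq W] (φ : W → V) (hφ : ∀ v x, v + φ x + φ x = v)
    (P : Finset V) (D : Finset (V × W))
    (hsymm : ∀ d ∈ D, (d.1 + φ d.2, d.2) ∈ D) (hP : ∀ d ∈ D, d.1 ∈ P)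
    (δ : ℕ) (hD : 2 * δ * #P < #D) :
    ∃ Q ⊆ P, Q.Nonempty ∧ ∀ v ∈ Q, δ ≤ #{x : W | (v, x) ∈ D ∧ v + φ x ∈ Q} := by
  let e : Finset V → ℕ := fun Q => #{d ∈ D | d.1 ∈ Q ∧ d.1 + φ d.2 ∈ Q}
  obtain ⟨Q, hQ, hmax⟩ := Finset.exists_max_image P.powerset
    (fun Q => (e Q : ℤ) - 2 * δ * #Q) ⟨P, by simp⟩
  rw [Finset.mem_powerset] at hQ
  have heP : e P = #D := by
    simp only [e]
    congr 1
    exact Finset.filter_true_of_mem fun d hd => ⟨hP d hd, hP _ (hsymm d hd)⟩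
  refine ⟨Q, hQ, ?_, fun v hv => ?_⟩
  · rw [Finset.nonempty_iff_ne_empty]
    rintro rfl
    have := hmax P (by simp)
    simp only [heP] at this
    simp [e] at this
    zify at hD
    linarith
  · have h1 := hmax (Q.erase v) (by
      rw [Finset.mem_powerset]; exact (Finset.erase_subset _ _).trans hQ)
    have h2 : e Q ≤ e (Q.erase v) + (#{x : W | (v, x) ∈ D ∧ v + φ x ∈ Q} +
        #{x : W | (v, x) ∈ D ∧ v + φ x ∈ Q}) := by
      have hsub : {d ∈ D | d.1 ∈ Q ∧ d.1 + φ d.2 ∈ Q} ⊆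
          {d ∈ D | d.1 ∈ Q.erase v ∧ d.1 + φ d.2 ∈ Q.erase v} ∪
          (({x : W | (v, x) ∈ D ∧ v + φ x ∈ Q} : Finset W).image (fun x => (v, x)) ∪
          ({x : W | (v, x) ∈ D ∧ v + φ x ∈ Q} : Finset W).image (fun x => (v + φ x, x))) := by
        rintro ⟨w, x⟩ hd
        simp only [Finset.mem_filter, Finset.mem_union, Finset.mem_image, Finset.mem_erase,
          Finset.mem_univ, true_and, Prod.mk.injEq] at hd ⊢
        by_cases hw : w = v
        · subst hw
          exact Or.inr (Or.inl ⟨x, ⟨hd.1, hd.2.2⟩, rfl, rfl⟩)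
        · by_cases hw' : w + φ x = v
          · refine Or.inr (Or.inr ⟨x, ⟨?_, ?_⟩, ?_, rfl⟩)
            · rw [← hw']; exact hsymm _ hd.1
            · rw [← hw', hφ]; exact hd.2.1
            · rw [← hw', hφ]
          · exact Or.inl ⟨hd.1, ⟨hw, hd.2.1⟩, hw', hd.2.2⟩
      refine (Finset.card_le_card hsub).trans ((Finset.card_union_le _ _).trans ?_)
      refine Nat.add_le_add_left ((Finset.card_union_le _ _).trans ?_) _
      exact Nat.add_le_add Finset.card_image_le Finset.card_image_le
    have h3 : (#(Q.erase v) : ℤ) = #Q - 1 := by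
      rw [Finset.card_erase_of_mem hv]
      have := Finset.card_pos.2 ⟨v, hv⟩
      omega
    rw [h3] at h1
    zify at h2 ⊢
    linarith

/-- The vectors traced by the walks with at most `j` steps from `v` that stay in `Q`. -/
noncomputable def walkVectors {V W : Type*} [AddCommGroup V] [AddCommGroup W] [Fintype W]
    (φ : W → V) (D : Finset (V × W)) (Q : Finset V) (v : V) : ℕ → Finset W
  | 0 => {0}
  | j + 1 => by
    classical
    exact walkVectors φ D Q v j ∪ (walkVectors φ D Q v j).biUnion fun x =>
      ({y : W | (v + φ x, y) ∈ D ∧ v + φ x + φ y ∈ Q} : Finset W).image (fun y => x + y)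

/-- A Moore bound: a graph whose darts `(v, x)` run from `v` to `v + φ x`, with labels `x` of
weight at most two, has a short closed walk of nonzero total label provided that it is dense and
each coordinate occurs in at most `t` labels at each vertex. -/
theorem exists_short_kernel_vector {V ι : Type*} [AddCommGroup V] [Module (ZMod 2) V]
    [Fintype ι] [DecidableEq V] [DecidableEq ι]
    (φ : (ι → ZMod 2) →ₗ[ZMod 2] V) (K : Submodule (ZMod 2) (ι → ZMod 2))
    (P : Finset V) (D : Finset (V × (ι → ZMod 2)))
    (hsymm : ∀ d ∈ D, (d.1 + φ d.2, d.2) ∈ D) (hP : ∀ d ∈ D, d.1 ∈ P)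
    (hK : ∀ d ∈ D, d.2 ∈ K) (hne : ∀ d ∈ D, d.2 ≠ 0) (hwt : ∀ d ∈ D, hammingNorm d.2 ≤ 2)
    (t : ℕ) (ht : ∀ v c, #{x : ι → ZMod 2 | (v, x) ∈ D ∧ x c ≠ 0} ≤ t)
    (hD : 2 * (4 * t * Nat.log 2 #P + 1) * #P < #D) :
    ∃ x ∈ K, x ≠ 0 ∧ φ x = 0 ∧ hammingNorm x ≤ 4 * (Nat.log 2 #P + 1) := by
  classical
  by_contra! hcon
  have hφ : ∀ (v : V) (x : ι → ZMod 2), v + φ x + φ x = v := by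
    intro v x
    rw [add_assoc, ← map_add, ZModModule.add_self, map_zero, add_zero]
  obtain ⟨Q, hQP, ⟨v, hv⟩, hdeg⟩ := exists_induced_minDegree φ hφ P D hsymm hP _ hD
  set R := walkVectors φ D Q v with hR
  have hmem : ∀ j y, y ∈ R (j + 1) ↔ y ∈ R j ∨
      ∃ x ∈ R j, ∃ z, ((v + φ x, z) ∈ D ∧ v + φ x + φ z ∈ Q) ∧ x + z = y := by
    intro j y
    simp only [hR, walkVectors, Finset.mem_union, Finset.mem_biUnion, Finset.mem_image,
      Finset.mem_filter, Finset.mem_univ, true_and]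
  have hinv : ∀ j, ∀ x ∈ R j, v + φ x ∈ Q ∧ x ∈ K ∧ hammingNorm x ≤ 2 * j := by
    intro j
    induction j with
    | zero =>
      intro x hx
      have : x = 0 := by simpa [hR, walkVectors] using hx
      subst this
      simpa using hv
    | succ j ih =>
      intro y hy
      rcases (hmem j y).1 hy with h | ⟨x, hx, z, ⟨hz, hzQ⟩, rfl⟩
      · obtain ⟨a, b, c⟩ := ih y h
        exact ⟨a, b, by omega⟩
      · obtain ⟨a, b, c⟩ := ih x hx
        refine ⟨by rw [map_add, ← add_assoc]; exact hzQ, K.add_mem b (hK _ hz), ?_⟩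
        have h1 : hammingNorm (x + z) ≤ hammingNorm x + hammingNorm z := by
          have := hammingDist_triangle (x + z) x 0
          rw [hammingDist_zero_right, hammingDist_zero_right, hammingDist_comm,
            hammingDist_eq_hammingNorm, neg_add_cancel_left] at this
          omega
        have h2 : hammingNorm z ≤ 2 := hwt _ hz
        omega
  have hmono : ∀ j, R j ⊆ R (j + 1) := fun j y hy => (hmem j y).2 (Or.inl hy)
  have hcardP : ∀ j, j ≤ Nat.log 2 #P + 1 → #(R j) ≤ #P := by
    intro j hj
    refine Finset.card_le_card_of_injOn (fun x => v + φ x)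
      (fun x hx => hQP (hinv j x hx).1) ?_
    intro x hx y hy hxy
    simp only [add_right_inj] at hxy
    by_contra hne'
    obtain ⟨-, hxK, hxn⟩ := hinv j x hx
    obtain ⟨-, hyK, hyn⟩ := hinv j y hy
    have h1 := hcon (x - y) (K.sub_mem hxK hyK) (sub_ne_zero.2 hne')
      (by rw [map_sub, hxy, sub_self])
    have h2 : hammingNorm (x - y) ≤ hammingNorm x + hammingNorm y := by
      have := hammingDist_triangle y 0 x
      rw [hammingDist_zero_right, hammingDist_zero_left, hammingDist_eq_hammingNorm,
        neg_add_eq_sub] at this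
      omega
    omega
  obtain ⟨j, hj, hgrow⟩ : ∃ j ≤ Nat.log 2 #P, #(R (j + 1)) ≤ 2 * #(R j) := by
    by_contra! hg
    have : ∀ j ≤ Nat.log 2 #P + 1, 2 ^ j ≤ #(R j) := by
      intro j
      induction j with
      | zero => intro _; simp [hR, walkVectors]
      | succ j ih =>
        intro hj
        have h1 := ih (by omega)
        have h2 := hg j (by omega)
        rw [pow_succ]
        omega
    have h1 := this _ le_rfl
    have h2 := hcardP _ le_rfl
    have h3 : #P < 2 ^ (Nat.log 2 #P + 1) := Nat.lt_pow_succ_log_self one_lt_two _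
    omega
  let F : (ι → ZMod 2) → (ι → ZMod 2) → Prop := fun x y => (v + φ x, x + y) ∈ D
  have hup := sum_card_related_le F
    (by
      intro x y h
      have := hsymm _ h
      simp only [F]
      rw [map_add, ← add_assoc, hφ] at this
      rwa [add_comm y x])
    (by
      intro x h
      exact hne _ h (ZModModule.add_self x))
    t (R (j + 1)) (by
      intro x hx c
      refine le_trans (Finset.card_le_card_of_injOn (fun y => x + y) ?_ ?_) (ht (v + φ x) c)
      · intro y hy
        simp only [Finset.coe_filter, Set.mem_ofPred_eq, Finset.mem_univ, true_and, F] at hy ⊢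
        refine ⟨hy.2.1, fun h => hy.2.2 ?_⟩
        rw [Pi.add_apply, CharTwo.add_eq_zero] at h
        exact h.symm
      · intro y _ z _ h
        simpa using h)
  have hlow : (4 * t * Nat.log 2 #P + 1) * #(R j) ≤
      ∑ x ∈ R (j + 1), #{y ∈ R (j + 1) | F x y} := by
    rw [mul_comm, ← smul_eq_mul]
    refine le_trans (Finset.card_nsmul_le_sum (R j) (fun x => #{y ∈ R (j + 1) | F x y}) _ ?_)
      (Finset.sum_le_sum_of_subset (hmono j))
    intro x hx
    refine (hdeg _ (hinv j x hx).1).trans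
      (Finset.card_le_card_of_injOn (fun y => x + y) ?_ ?_)
    · intro y hy
      simp only [Finset.coe_filter, Set.mem_ofPred_eq, Finset.mem_univ, true_and, F] at hy ⊢
      refine ⟨(hmem j _).2 (Or.inr ⟨x, hx, y, hy, rfl⟩), ?_⟩
      rw [← add_assoc, ZModModule.add_self, zero_add]
      exact hy.1
    · intro y _ z _ h
      simpa using h
  have hpos : 0 < #(R j) := by
    rcases Nat.eq_zero_or_pos #(R j) with h | h
    · have h0 : ∀ i, 0 ∈ R i := by
        intro i
        induction i with
        | zero => simp [hR, walkVectors]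
        | succ i ih => exact hmono i ih
      exact Finset.card_pos.2 ⟨0, h0 j⟩
    · exact h
  have hl : Nat.log 2 #(R (j + 1)) ≤ Nat.log 2 #P :=
    Nat.log_mono_right (hcardP _ (by omega))
  have h1 : #(R (j + 1)) * Nat.log 2 #(R (j + 1)) ≤ 2 * #(R j) * Nat.log 2 #P :=
    Nat.mul_le_mul hgrow hl
  have h2 : (4 * t * Nat.log 2 #P + 1) * #(R j) ≤ 2 * t * (2 * #(R j) * Nat.log 2 #P) := by
    refine (hlow.trans (le_of_eq ?_)).trans (hup.trans (Nat.mul_le_mul_left (2 * t) h1))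
    congr!
  linarith [show (4 * t * Nat.log 2 #P + 1) * #(R j) =
    2 * t * (2 * #(R j) * Nat.log 2 #P) + #(R j) by ring]

/-- A Markov inequality for multiplicities: if the fibres of `κ` are small on average, then few
elements lie in large fibres. -/
theorem card_large_fibre_le {E γ : Type*} [DecidableEq γ] (s : Finset E) (κ : E → γ) (τ : ℕ)
    (h : ∑ e ∈ s, #{e' ∈ s | κ e' = κ e} ≤ τ * #s) :
    8 * #{e ∈ s | 8 * τ < #{e' ∈ s | κ e' = κ e}} ≤ #s := by
  set b := {e ∈ s | 8 * τ < #{e' ∈ s | κ e' = κ e}} with hb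
  have h1 : #b * (8 * τ + 1) ≤ τ * #s := by
    refine le_trans ?_ h
    refine le_trans ?_ (Finset.sum_le_sum_of_subset (Finset.filter_subset _ _ : b ⊆ s))
    rw [← smul_eq_mul]
    refine Finset.card_nsmul_le_sum _ _ _ fun e he => ?_
    exact (Finset.mem_filter.1 he).2
  rcases Nat.eq_zero_or_pos τ with rfl | hτ
  · have : #b = 0 := by simpa using h1
    omega
  · refine Nat.le_of_mul_le_mul_left ?_ hτ
    nlinarith

/-- A variant of `exists_short_kernel_vector` for graphs with labels `single c + single c'` in
which the local multiplicities are only bounded on average. -/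
theorem exists_short_kernel_vector_of_average {V ι E : Type*} [AddCommGroup V]
    [Module (ZMod 2) V] [Fintype ι] [DecidableEq V] [DecidableEq ι]
    (φ : (ι → ZMod 2) →ₗ[ZMod 2] V) (K : Submodule (ZMod 2) (ι → ZMod 2))
    (P : Finset V) (s : Finset E) (src tgt : E → V) (lf rt : E → ι)
    (hsrc : ∀ e ∈ s, src e ∈ P) (htgt : ∀ e ∈ s, tgt e ∈ P)
    (hφ : ∀ e ∈ s, src e + φ (Pi.single (lf e) 1 + Pi.single (rt e) 1) = tgt e)
    (hK : ∀ e ∈ s, Pi.single (lf e) 1 + Pi.single (rt e) 1 ∈ K)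
    (hlr : ∀ e ∈ s, ∀ e' ∈ s, lf e ≠ rt e')
    (hinj : ∀ e ∈ s, ∀ e' ∈ s, src e = src e' → lf e = lf e' → rt e = rt e' → e = e')
    (τ : ℕ)
    (h₁ : ∑ e ∈ s, #{e' ∈ s | (src e', lf e') = (src e, lf e)} ≤ τ * #s)
    (h₂ : ∑ e ∈ s, #{e' ∈ s | (src e', rt e') = (src e, rt e)} ≤ τ * #s)
    (h₃ : ∑ e ∈ s, #{e' ∈ s | (tgt e', lf e') = (tgt e, lf e)} ≤ τ * #s)
    (h₄ : ∑ e ∈ s, #{e' ∈ s | (tgt e', rt e') = (tgt e, rt e)} ≤ τ * #s)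
    (hbig : 4 * (4 * (32 * τ) * Nat.log 2 #P + 1) * #P < #s) :
    ∃ x ∈ K, x ≠ 0 ∧ φ x = 0 ∧ hammingNorm x ≤ 4 * (Nat.log 2 #P + 1) := by
  classical
  let κ : Fin 4 → E → V × ι := ![fun e => (src e, lf e), fun e => (src e, rt e),
    fun e => (tgt e, lf e), fun e => (tgt e, rt e)]
  let L : E → ι → ZMod 2 := fun e => Pi.single (lf e) 1 + Pi.single (rt e) 1
  have hLc : ∀ e c, L e c ≠ 0 → c = lf e ∨ c = rt e := by
    intro e c h
    by_contra! hc
    exact h (by simp [L, hc.1, hc.2])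
  have hLl : ∀ e ∈ s, L e (lf e) = 1 := fun e he => by simp [L, hlr e he e he]
  have hLr : ∀ e ∈ s, L e (rt e) = 1 := fun e he => by simp [L, (hlr e he e he).symm]
  let bad : Fin 4 → Finset E := fun i => {e ∈ s | 8 * τ < #{e' ∈ s | κ i e' = κ i e}}
  have hbad : ∀ i, 8 * #(bad i) ≤ #s := by
    intro i
    refine card_large_fibre_le s (κ i) τ ?_
    fin_cases i <;> assumption
  let good : Finset E := s \ (Finset.univ.biUnion bad)
  have hgs : good ⊆ s := Finset.sdiff_subset
  have hgood : #s ≤ 2 * #good := by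
    have h1 : #s ≤ #good + #(Finset.univ.biUnion bad) := by
      have := Finset.le_card_sdiff (Finset.univ.biUnion bad) s
      simp only [good]
      omega
    have h2 : #(Finset.univ.biUnion bad) ≤ ∑ i, #(bad i) := Finset.card_biUnion_le
    rw [Fin.sum_univ_four] at h2
    have := hbad 0
    have := hbad 1
    have := hbad 2
    have := hbad 3
    omega
  have hfib : ∀ i k, #{e ∈ good | κ i e = k} ≤ 8 * τ := by
    intro i k
    rcases ({e ∈ good | κ i e = k} : Finset E).eq_empty_or_nonempty with h | ⟨e, he⟩
    · rw [h]; simp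
    · obtain ⟨heg, rfl⟩ := Finset.mem_filter.1 he
      have h1 : e ∉ bad i := fun h =>
        (Finset.mem_sdiff.1 heg).2 (Finset.mem_biUnion.2 ⟨i, Finset.mem_univ _, h⟩)
      have h2 : #{e' ∈ s | κ i e' = κ i e} ≤ 8 * τ := by
        by_contra! h
        exact h1 (Finset.mem_filter.2 ⟨hgs heg, h⟩)
      exact (Finset.card_le_card (Finset.filter_subset_filter _ hgs)).trans h2
  let D : Finset (V × (ι → ZMod 2)) :=
    good.image (fun e => (src e, L e)) ∪ good.image (fun e => (tgt e, L e))
  have hmemD : ∀ d, d ∈ D ↔ ∃ e ∈ good, d = (src e, L e) ∨ d = (tgt e, L e) := by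
    intro d
    simp only [D, Finset.mem_union, Finset.mem_image]
    constructor
    · rintro (⟨e, he, rfl⟩ | ⟨e, he, rfl⟩)
      · exact ⟨e, he, Or.inl rfl⟩
      · exact ⟨e, he, Or.inr rfl⟩
    · rintro ⟨e, he, rfl | rfl⟩
      · exact Or.inl ⟨e, he, rfl⟩
      · exact Or.inr ⟨e, he, rfl⟩
  refine exists_short_kernel_vector φ K P D ?_ ?_ ?_ ?_ ?_ (32 * τ) ?_ ?_
  · intro d hd
    obtain ⟨e, he, rfl | rfl⟩ := (hmemD d).1 hd
    · exact (hmemD _).2 ⟨e, he, Or.inr (by simp only [L]; rw [hφ e (hgs he)])⟩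
    · refine (hmemD _).2 ⟨e, he, Or.inl ?_⟩
      simp only [L]
      rw [← hφ e (hgs he), add_assoc, ← map_add, ZModModule.add_self, map_zero, add_zero]
  · intro d hd
    obtain ⟨e, he, rfl | rfl⟩ := (hmemD d).1 hd
    · exact hsrc e (hgs he)
    · exact htgt e (hgs he)
  · intro d hd
    obtain ⟨e, he, rfl | rfl⟩ := (hmemD d).1 hd <;> exact hK e (hgs he)
  · intro d hd h0
    obtain ⟨e, he, rfl | rfl⟩ := (hmemD d).1 hd <;>
    · have := hLl e (hgs he)
      rw [show L e = 0 from h0] at this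
      simp at this
  · intro d hd
    have key : ∀ e, hammingNorm (L e) ≤ 2 := by
      intro e
      refine le_trans (Finset.card_le_card (t := {lf e, rt e}) fun c hc => ?_)
        Finset.card_le_two
      simpa using hLc e c (Finset.mem_filter.1 hc).2
    obtain ⟨e, he, rfl | rfl⟩ := (hmemD d).1 hd <;> exact key e
  · intro v c
    refine (Finset.card_le_card (t := Finset.univ.biUnion fun i =>
      ({e ∈ good | κ i e = (v, c)} : Finset E).image L) ?_).trans (Finset.card_biUnion_le.trans ?_)
    · intro x hx
      obtain ⟨-, hxD, hxc⟩ := Finset.mem_filter.1 hx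
      obtain ⟨e, he, h⟩ := (hmemD _).1 hxD
      simp only [Prod.mk.injEq] at h
      simp only [Finset.mem_biUnion, Finset.mem_univ, true_and, Finset.mem_image,
        Finset.mem_filter]
      rcases h with ⟨rfl, rfl⟩ | ⟨rfl, rfl⟩ <;> rcases hLc e c hxc with rfl | rfl
      · exact ⟨0, e, ⟨he, rfl⟩, rfl⟩
      · exact ⟨1, e, ⟨he, rfl⟩, rfl⟩
      · exact ⟨2, e, ⟨he, rfl⟩, rfl⟩
      · exact ⟨3, e, ⟨he, rfl⟩, rfl⟩
    · refine (Finset.sum_le_sum fun i _ => Finset.card_image_le.trans (hfib i _)).trans ?_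
      simp
      omega
  · have hDg : #good ≤ #D := by
      refine le_trans (le_of_eq ?_) (Finset.card_le_card Finset.subset_union_left)
      refine (Finset.card_image_of_injOn fun e he e' he' h => ?_).symm
      have hes := hgs he
      have hes' := hgs he'
      simp only [Prod.mk.injEq] at h
      refine hinj e hes e' hes' h.1 ?_ ?_
      · rcases hLc e' (lf e) (by rw [← h.2, hLl e hes]; exact one_ne_zero) with h' | h'
        · exact h'
        · exact absurd h' (hlr e hes e' hes')
      · rcases hLc e' (rt e) (by rw [← h.2, hLr e hes]; exact one_ne_zero) with h' | h'
        · exact absurd h'.symm (hlr e' hes' e hes)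
        · exact h'
    have : 2 * (2 * (4 * (32 * τ) * Nat.log 2 #P + 1) * #P) < 2 * #D := by
      calc _ = 4 * (4 * (32 * τ) * Nat.log 2 #P + 1) * #P := by ring
        _ < #s := hbig
        _ ≤ 2 * #D := by omega
    omega

/-- Bounding the average multiplicity of the pairs `(f x p, g p)`, for `p ∈ Q` and `x ∈ act p`, by
the sizes of intersections. -/
theorem sum_card_fibre_le {S T ι : Type*} [DecidableEq S] [DecidableEq ι]
    (Q : Finset T) (act act' : T → Finset S)
    (f : S → T → S) (hf : ∀ p ∈ Q, ∀ x ∈ act p, f x p ∈ act' p)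
    (hinj : ∀ p x y, f x p = f y p → x = y) (g : T → ι) (m : ℕ)
    (hm : ∀ p ∈ Q, ∑ p' ∈ Q with g p' = g p, #(act' p ∩ act' p') ≤ m) :
    ∑ e ∈ Q.sigma act,
      #{e' ∈ Q.sigma act | (f e'.2 e'.1, g e'.1) = (f e.2 e.1, g e.1)} ≤ m * #Q := by
  rw [← Finset.card_sigma]
  calc _ ≤ #(Q.sigma fun p => ({p' ∈ Q | g p' = g p} : Finset T).sigma
        fun p' => act' p ∩ act' p') := by
        refine Finset.card_le_card_of_injOn
          (fun e => ⟨e.1.1, e.2.1, f e.1.2 e.1.1⟩) ?_ ?_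
        · rintro ⟨⟨p, x⟩, ⟨p', x'⟩⟩ he
          simp only [Finset.coe_sigma, Finset.mem_coe, Finset.mem_sigma, Finset.mem_filter,
            Set.mem_sigma_iff, Prod.mk.injEq, Finset.mem_inter] at he ⊢
          obtain ⟨⟨hp, hx⟩, ⟨hp', hx'⟩, h1, h2⟩ := he
          exact ⟨hp, ⟨hp', h2⟩, hf p hp x hx, h1 ▸ hf p' hp' x' hx'⟩
        · rintro ⟨⟨p, x⟩, ⟨p', x'⟩⟩ he ⟨⟨q, y⟩, ⟨q', y'⟩⟩ he' h
          simp only [Finset.coe_sigma, Finset.mem_coe, Finset.mem_sigma, Finset.mem_filter,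
            Set.mem_sigma_iff, Prod.mk.injEq] at he he'
          simp only [Sigma.mk.injEq] at h
          obtain ⟨rfl, h⟩ := h
          rw [heq_iff_eq, Sigma.mk.injEq] at h
          obtain ⟨rfl, h⟩ := h
          rw [heq_iff_eq] at h
          obtain rfl := hinj _ _ _ h
          obtain rfl := hinj p' x' y' (by rw [he.2.2.1, he'.2.2.1])
          rfl
    _ ≤ m * #Q := by
        rw [Finset.card_sigma, mul_comm, ← smul_eq_mul]
        refine Finset.sum_le_card_nsmul _ _ _ fun p hp => ?_
        rw [Finset.card_sigma]
        exact hm p hp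

/-- The `ℓ`-element sets containing `A` and avoiding `B`. -/
def window {X : Type*} [Fintype X] [DecidableEq X] (ℓ : ℕ) (A B : Finset X) :
    Finset (Finset X) :=
  {S ∈ powersetCard ℓ univ | A ⊆ S ∧ Disjoint S B}

theorem mem_window {X : Type*} [Fintype X] [DecidableEq X] {ℓ : ℕ} {A B S : Finset X} :
    S ∈ window ℓ A B ↔ #S = ℓ ∧ A ⊆ S ∧ Disjoint S B := by
  simp [window]

theorem card_window {X : Type*} [Fintype X] [DecidableEq X] {ℓ : ℕ} {A B : Finset X}
    (hAB : Disjoint A B) (hA : #A ≤ ℓ) :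
    #(window ℓ A B) = (Fintype.card X - #A - #B).choose (ℓ - #A) := by
  have hc : #(univ \ (A ∪ B)) = Fintype.card X - #A - #B := by
    rw [Finset.card_sdiff_of_subset (Finset.subset_univ _), Finset.card_union_of_disjoint hAB,
      Finset.card_univ, Nat.sub_sub]
  rw [← hc, ← Finset.card_powersetCard]
  refine Finset.card_nbij' (fun S => S \ A) (fun S => S ∪ A) ?_ ?_ ?_ ?_
  · intro S hS
    obtain ⟨h1, h2, h3⟩ := mem_window.1 hS
    refine Finset.mem_coe.2 (Finset.mem_powersetCard.2 ⟨?_, ?_⟩)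
    · intro x hx
      have := Finset.disjoint_left.1 h3 (Finset.mem_sdiff.1 hx).1
      have := (Finset.mem_sdiff.1 hx).2
      simp_all
    · rw [Finset.card_sdiff_of_subset h2, h1]
  · intro S hS
    obtain ⟨h1, h2⟩ := Finset.mem_powersetCard.1 (Finset.mem_coe.1 hS)
    have hd : Disjoint S (A ∪ B) := Finset.disjoint_left.2 fun x hx => by
      have := h1 hx
      simp only [Finset.mem_sdiff] at this
      exact this.2
    rw [Finset.disjoint_union_right] at hd
    refine Finset.mem_coe.2 (mem_window.2 ⟨?_, Finset.subset_union_right, ?_⟩)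
    · rw [Finset.card_union_of_disjoint hd.1, h2]; omega
    · exact Finset.disjoint_union_left.2 ⟨hd.2, hAB⟩
  · intro S hS
    exact Finset.sdiff_union_of_subset (mem_window.1 hS).2.1
  · intro S hS
    obtain ⟨h1, h2⟩ := Finset.mem_powersetCard.1 (Finset.mem_coe.1 hS)
    refine Finset.union_sdiff_cancel_right (Finset.disjoint_left.2 fun x hx hxA => ?_)
    have := h1 hx
    simp [hxA] at this

/-- Shrinking both arguments of a binomial coefficient by `s` costs a factor of at most `θ ^ s`. -/
theorem choose_sub_sub_le_s17 {θ : ℝ} (h0 : 0 ≤ θ) (h1 : θ ≤ 1) (s : ℕ) :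
    ∀ N L : ℕ, s ≤ L → (L : ℝ) ≤ θ * N →
      (((N - s).choose (L - s) : ℕ) : ℝ) ≤ θ ^ s * (N.choose L : ℕ) := by
  induction s with
  | zero => intro N L _ _; simp
  | succ s ih =>
    intro N L hs hL
    obtain ⟨L, rfl⟩ : ∃ L', L = L' + 1 := ⟨L - 1, by omega⟩
    rcases Nat.eq_zero_or_pos N with rfl | hN
    · exfalso
      push_cast at hL
      have : (0 : ℝ) ≤ L := Nat.cast_nonneg _
      linarith
    obtain ⟨N, rfl⟩ : ∃ N', N = N' + 1 := ⟨N - 1, by omega⟩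
    rw [Nat.add_sub_add_right, Nat.add_sub_add_right]
    push_cast at hL
    refine (ih N L (by omega) (by nlinarith)).trans ?_
    rw [pow_succ, mul_assoc]
    refine mul_le_mul_of_nonneg_left ?_ (by positivity)
    have h2 : ((N : ℝ) + 1) * (N.choose L : ℕ) = ((N + 1).choose (L + 1) : ℕ) * ((L : ℝ) + 1) := by
      exact_mod_cast Nat.add_one_mul_choose_eq N L
    have hN' : (0 : ℝ) < N + 1 := by positivity
    refine le_of_mul_le_mul_left ?_ hN'
    rw [h2]
    have : (0 : ℝ) ≤ ((N + 1).choose (L + 1) : ℕ) := Nat.cast_nonneg _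
    nlinarith

/-- Two windows have a small intersection when the sets they prescribe differ much. -/
theorem card_window_inter_le {X : Type*} [Fintype X] [DecidableEq X] {ℓ r : ℕ}
    {A B A' B' : Finset X} (hA : #A = r) (hB : #B = r) {θ : ℝ} (h0 : 0 ≤ θ) (h1 : θ ≤ 1)
    (hθ : ((ℓ - r : ℕ) : ℝ) ≤ θ * (Fintype.card X - r - r : ℕ)) :
    (#(window ℓ A B ∩ window ℓ A' B') : ℝ) ≤
      θ ^ #(A' \ A) * ((Fintype.card X - r - r).choose (ℓ - r) : ℕ) := by
  have hsub : window ℓ A B ∩ window ℓ A' B' ⊆ window ℓ (A ∪ A') B := by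
    intro S hS
    rw [Finset.mem_inter, mem_window, mem_window] at hS
    exact mem_window.2 ⟨hS.1.1, Finset.union_subset hS.1.2.1 hS.2.2.1, hS.1.2.2⟩
  rcases (window ℓ (A ∪ A') B).eq_empty_or_nonempty with he | ⟨S, hS⟩
  · rw [he, Finset.subset_empty] at hsub
    rw [hsub, Finset.card_empty, Nat.cast_zero]
    positivity
  · obtain ⟨hSl, hSs, hSd⟩ := mem_window.1 hS
    have hu : #(A ∪ A') = r + #(A' \ A) := by
      rw [← Finset.union_sdiff_self_eq_union, Finset.card_union_of_disjoint Finset.disjoint_sdiff,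
        hA]
    have hle : r + #(A' \ A) ≤ ℓ := by rw [← hu, ← hSl]; exact Finset.card_le_card hSs
    refine (Nat.cast_le.2 (Finset.card_le_card hsub)).trans ?_
    rw [card_window (hSd.mono_left hSs) (by omega), hu, hB]
    have := choose_sub_sub_le_s17 h0 h1 #(A' \ A) (Fintype.card X - r - r) (ℓ - r) (by omega) hθ
    rwa [← Nat.sub_sub, ← Nat.sub_sub, Nat.sub_right_comm (_ - r)]

/-- The indicator vector of a set over the field with two elements. -/
def indVec {X : Type*} [DecidableEq X] (S : Finset X) : X → ZMod 2 :=
  fun a => if a ∈ S then 1 else 0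

theorem indVec_injective {X : Type*} [DecidableEq X] :
    Function.Injective (indVec : Finset X → X → ZMod 2) := by
  intro S T h
  ext a
  have := congrFun h a
  by_cases h1 : a ∈ S <;> by_cases h2 : a ∈ T <;> simp_all [indVec]

theorem indVec_symmDiff {X : Type*} [DecidableEq X] (S T : Finset X) :
    indVec (symmDiff S T) = indVec S + indVec T := by
  ext a
  by_cases h1 : a ∈ S <;> by_cases h2 : a ∈ T <;>
    simp [indVec, h1, h2, Finset.mem_symmDiff, CharTwo.add_self_eq_zero]

theorem symmDiff_mem_window {X : Type*} [Fintype X] [DecidableEq X] {ℓ : ℕ}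
    {A B S : Finset X} (hAB : Disjoint A B) (hc : #A = #B) (hS : S ∈ window ℓ A B) :
    symmDiff S (A ∪ B) ∈ window ℓ B A := by
  obtain ⟨h1, h2, h3⟩ := mem_window.1 hS
  have : symmDiff S (A ∪ B) = (S \ A) ∪ B := by
    ext x
    have h4 : x ∈ A → x ∈ S := fun h => h2 h
    have h5 : x ∈ S → x ∉ B := fun h => Finset.disjoint_left.1 h3 h
    have h6 : x ∈ A → x ∉ B := fun h => Finset.disjoint_left.1 hAB h
    simp only [Finset.mem_symmDiff, Finset.mem_union, Finset.mem_sdiff]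
    tauto
  rw [this]
  refine mem_window.2 ⟨?_, Finset.subset_union_right, ?_⟩
  · rw [Finset.card_union_of_disjoint (h3.mono_left Finset.sdiff_subset),
      Finset.card_sdiff_of_subset h2, ← hc, h1]
    have := Finset.card_le_card h2
    omega
  · exact Finset.disjoint_union_left.2 ⟨Finset.sdiff_disjoint, hAB.symm⟩

/-- The Kikuchi graph argument: vertices are the `ℓ`-element subsets of `X`, and a pair `p ∈ Q`
joins the sets containing `A p` and avoiding `B p` to those with the roles of `A p` and `B p`
exchanged. -/
theorem exists_short_kernel_vector_of_pairs {X ι : Type*} [Fintype X] [Fintype ι]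
    [DecidableEq X] [DecidableEq ι]
    (Q : Finset (ι × ι)) (A B : ι × ι → Finset X)
    (φ : (ι → ZMod 2) →ₗ[ZMod 2] (X → ZMod 2)) (K : Submodule (ZMod 2) (ι → ZMod 2))
    (hφ : ∀ p ∈ Q, φ (Pi.single p.1 1 + Pi.single p.2 1) = indVec (A p ∪ B p))
    (hK : ∀ p ∈ Q, Pi.single p.1 1 + Pi.single p.2 1 ∈ K)
    (hlr : ∀ p ∈ Q, ∀ p' ∈ Q, p.1 ≠ p'.2)
    (ℓ r : ℕ) (hr : r ≤ ℓ) (hA : ∀ p ∈ Q, #(A p) = r) (hB : ∀ p ∈ Q, #(B p) = r)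
    (hAB : ∀ p ∈ Q, Disjoint (A p) (B p))
    (θ : ℝ) (h0 : 0 ≤ θ) (h1 : θ ≤ 1)
    (hθ : ((ℓ - r : ℕ) : ℝ) ≤ θ * (Fintype.card X - r - r : ℕ)) (τ : ℕ)
    (hA₁ : ∀ p ∈ Q, ∑ p' ∈ Q with p'.1 = p.1, θ ^ #(A p' \ A p) ≤ τ)
    (hA₂ : ∀ p ∈ Q, ∑ p' ∈ Q with p'.2 = p.2, θ ^ #(A p' \ A p) ≤ τ)
    (hB₁ : ∀ p ∈ Q, ∑ p' ∈ Q with p'.1 = p.1, θ ^ #(B p' \ B p) ≤ τ)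
    (hB₂ : ∀ p ∈ Q, ∑ p' ∈ Q with p'.2 = p.2, θ ^ #(B p' \ B p) ≤ τ)
    (hbig : 4 * (4 * (32 * τ) * Nat.log 2 ((Fintype.card X).choose ℓ) + 1) *
      (Fintype.card X).choose ℓ < #Q * (Fintype.card X - r - r).choose (ℓ - r)) :
    ∃ x ∈ K, x ≠ 0 ∧ φ x = 0 ∧
      hammingNorm x ≤ 4 * (Nat.log 2 ((Fintype.card X).choose ℓ) + 1) := by
  set Z := (Fintype.card X - r - r).choose (ℓ - r) with hZ
  let P : Finset (X → ZMod 2) := (powersetCard ℓ (univ : Finset X)).image indVec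
  have hP : #P = (Fintype.card X).choose ℓ := by
    rw [Finset.card_image_of_injective _ indVec_injective, Finset.card_powersetCard,
      Finset.card_univ]
  let s := Q.sigma fun p => window ℓ (A p) (B p)
  have hs : #s = #Q * Z := by
    rw [Finset.card_sigma, Finset.sum_const_nat (m := Z)]
    intro p hp
    rw [card_window (hAB p hp) (by rw [hA p hp]; exact hr), hA p hp, hB p hp]
  have hmem : ∀ e ∈ s, e.1 ∈ Q ∧ e.2 ∈ window ℓ (A e.1) (B e.1) := fun e he =>
    Finset.mem_sigma.1 he
  have hmP : ∀ {S A B}, S ∈ window ℓ A B → indVec S ∈ P := fun {S A B} hS =>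
    Finset.mem_image_of_mem _ (by simpa using (mem_window.1 hS).1)
  have hcount : ∀ (C D : ι × ι → Finset X) (g : ι × ι → ι), (∀ p ∈ Q, #(C p) = r) →
      (∀ p ∈ Q, #(D p) = r) → (∀ p ∈ Q, ∑ p' ∈ Q with g p' = g p, θ ^ #(C p' \ C p) ≤ τ) →
      ∀ p ∈ Q, ∑ p' ∈ Q with g p' = g p,
        #(window ℓ (C p) (D p) ∩ window ℓ (C p') (D p')) ≤ τ * Z := by
    intro C D g hC hD hg p hp
    have : ((∑ p' ∈ Q with g p' = g p,
        #(window ℓ (C p) (D p) ∩ window ℓ (C p') (D p')) : ℕ) : ℝ) ≤ τ * Z := by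
      push_cast
      calc _ ≤ ∑ p' ∈ Q with g p' = g p, θ ^ #(C p' \ C p) * (Z : ℝ) :=
            Finset.sum_le_sum fun p' _ => card_window_inter_le (hC p hp) (hD p hp) h0 h1 hθ
        _ = (∑ p' ∈ Q with g p' = g p, θ ^ #(C p' \ C p)) * Z := by rw [Finset.sum_mul]
        _ ≤ τ * Z := mul_le_mul_of_nonneg_right (hg p hp) (Nat.cast_nonneg _)
    exact_mod_cast this
  have hid : ∀ g : ι × ι → ι,
      (∀ p ∈ Q, ∑ p' ∈ Q with g p' = g p, θ ^ #(A p' \ A p) ≤ τ) →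
      ∑ e ∈ s, #{e' ∈ s | (indVec e'.2, g e'.1) = (indVec e.2, g e.1)} ≤ τ * #s := by
    intro g hg
    have := sum_card_fibre_le Q (fun p => window ℓ (A p) (B p)) (fun p => window ℓ (A p) (B p))
      (fun S _ => S) (fun p _ x hx => hx) (fun _ _ _ h => h) g _ (hcount A B g hA hB hg)
    rw [hs]
    refine le_trans (le_of_eq (Finset.sum_congr rfl fun e _ => congrArg card
      (Finset.filter_congr fun e' _ => ?_))) (this.trans (le_of_eq (by ring)))
    simp only [Prod.mk.injEq, indVec_injective.eq_iff]
  have hflip : ∀ g : ι × ι → ι,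
      (∀ p ∈ Q, ∑ p' ∈ Q with g p' = g p, θ ^ #(B p' \ B p) ≤ τ) →
      ∑ e ∈ s, #{e' ∈ s | (indVec (symmDiff e'.2 (A e'.1 ∪ B e'.1)), g e'.1) =
        (indVec (symmDiff e.2 (A e.1 ∪ B e.1)), g e.1)} ≤ τ * #s := by
    intro g hg
    have := sum_card_fibre_le Q (fun p => window ℓ (A p) (B p)) (fun p => window ℓ (B p) (A p))
      (fun S p => symmDiff S (A p ∪ B p))
      (fun p hp x hx => symmDiff_mem_window (hAB p hp) ((hA p hp).trans (hB p hp).symm) hx)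
      (fun _ _ _ h => symmDiff_left_injective _ h) g _ (hcount B A g hB hA hg)
    rw [hs]
    refine le_trans (le_of_eq (Finset.sum_congr rfl fun e _ => congrArg card
      (Finset.filter_congr fun e' _ => ?_))) (this.trans (le_of_eq (by ring)))
    simp only [Prod.mk.injEq, indVec_injective.eq_iff]
  rw [← hP] at hbig ⊢
  refine exists_short_kernel_vector_of_average φ K P s (fun e => indVec e.2)
    (fun e => indVec (symmDiff e.2 (A e.1 ∪ B e.1))) (fun e => e.1.1) (fun e => e.1.2)
    (fun e he => hmP (hmem e he).2)
    (fun e he => hmP (symmDiff_mem_window (hAB _ (hmem e he).1)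
      ((hA _ (hmem e he).1).trans (hB _ (hmem e he).1).symm) (hmem e he).2))
    (fun e he => by rw [hφ _ (hmem e he).1, indVec_symmDiff])
    (fun e he => hK _ (hmem e he).1)
    (fun e he e' he' => hlr _ (hmem e he).1 _ (hmem e' he').1)
    ?_ τ (hid _ hA₁) (hid _ hA₂) (hflip _ hB₁) (hflip _ hB₂) (by rw [hs]; exact hbig)
  rintro ⟨p, S⟩ - ⟨p', S'⟩ - h h' h''
  obtain rfl : p = p' := Prod.ext h' h''
  obtain rfl : S = S' := indVec_injective h
  rfl

/-- A bucket: `b` hyperedges containing a common set of `i` vertices. -/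
def IsBucket {n : ℕ} (i b : ℕ) (B : Finset (Finset (Fin n))) : Prop :=
  #B = b ∧ ∃ U : Finset (Fin n), #U = i ∧ ∀ C ∈ B, U ⊆ C

open Classical in
/-- A dense uniform hypergraph contains, at some level `i`, many disjoint buckets such that sets
of more than `i` vertices have bounded degree in them. -/
theorem exists_buckets {n k : ℕ} (H : Finset (Finset (Fin n))) (hk : 0 < k)
    (hH : ∀ C ∈ H, #C = k) (b : ℕ → ℕ) (hb : ∀ i, 2 ≤ b i) (g : ℝ)
    (hg : n * b 1 + (k - 1 : ℕ) * g < #H) :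
    ∃ i, 0 < i ∧ i < k ∧ ∃ 𝓑 : Finset (Finset (Finset (Fin n))),
      (∀ B ∈ 𝓑, B ⊆ H ∧ IsBucket i (b i) B) ∧
      (∀ B ∈ 𝓑, ∀ B' ∈ 𝓑, B ≠ B' → Disjoint B B') ∧
      (∀ B ∈ 𝓑, ∀ W : Finset (Fin n), i < #W → #{C ∈ B | W ⊆ C} ≤ b #W) ∧
      g ≤ #𝓑 * b i := by
  by_contra! hcon
  have key : ∀ d < k, ∃ G ⊆ H, #H ≤ #G + d * g ∧
      ∀ W : Finset (Fin n), k - d ≤ #W → #{C ∈ G | W ⊆ C} < b #W := by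
    intro d
    induction d with
    | zero =>
      intro _
      refine ⟨H, subset_rfl, by simp, fun W hW => lt_of_le_of_lt ?_ (hb _)⟩
      refine Finset.card_le_one.2 fun C hC D hD => ?_
      rw [Finset.mem_filter] at hC hD
      rw [← Finset.eq_of_subset_of_card_le hC.2 (by rw [hH C hC.1]; omega),
        ← Finset.eq_of_subset_of_card_le hD.2 (by rw [hH D hD.1]; omega)]
    | succ d ih =>
      intro hd
      obtain ⟨G, hGH, hGc, hG⟩ := ih (by omega)
      set i := k - (d + 1) with hi
      let fam : Finset (Finset (Finset (Finset (Fin n)))) :=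
        {𝓑 ∈ G.powerset.powerset | (∀ B ∈ 𝓑, IsBucket i (b i) B) ∧
          ∀ B ∈ 𝓑, ∀ B' ∈ 𝓑, B ≠ B' → Disjoint B B'}
      obtain ⟨𝓑, h𝓑, hmax⟩ := Finset.exists_max_image fam card ⟨∅, by simp [fam]⟩
      simp only [fam, Finset.mem_filter, Finset.mem_powerset] at h𝓑 hmax
      obtain ⟨hsub, hbuck, hdisj⟩ := h𝓑
      have hBG : ∀ B ∈ 𝓑, B ⊆ G := fun B hB => Finset.mem_powerset.1 (hsub hB)
      have hlt := hcon i (by omega) (by omega) 𝓑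
        (fun B hB => ⟨(hBG B hB).trans hGH, hbuck B hB⟩) hdisj
        (fun B hB W hW => (Finset.card_le_card (Finset.filter_subset_filter _ (hBG B hB))).trans
          (hG W (by omega)).le)
      have hcardU : #(𝓑.biUnion id) = #𝓑 * b i := by
        rw [Finset.card_biUnion (t := id) (fun B hB B' hB' hne => hdisj B hB B' hB' hne)]
        exact Finset.sum_const_nat fun B hB => (hbuck B hB).1
      refine ⟨G \ 𝓑.biUnion id, Finset.sdiff_subset.trans hGH, ?_, fun W hW => ?_⟩
      · have h1 := Finset.le_card_sdiff (𝓑.biUnion id) G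
        rw [hcardU] at h1
        have h2 : (#G : ℝ) ≤ #(G \ 𝓑.biUnion id) + #𝓑 * b i := by
          exact_mod_cast (by omega : #G ≤ #(G \ 𝓑.biUnion id) + #𝓑 * b i)
        push_cast
        linarith
      · rcases Nat.lt_or_ge i #W with hW' | hW'
        · exact lt_of_le_of_lt (Finset.card_le_card
            (Finset.filter_subset_filter _ Finset.sdiff_subset)) (hG W (by omega))
        · have hWi : #W = i := le_antisymm hW' hW
          by_contra! hge
          rw [hWi] at hge
          obtain ⟨B, hB, hBc⟩ := Finset.exists_subset_card_eq hge
          have hB' : ∀ C ∈ B, C ∈ G ∧ C ∉ 𝓑.biUnion id ∧ W ⊆ C := fun C hC => by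
            have := hB hC
            rw [Finset.mem_filter, Finset.mem_sdiff] at this
            exact ⟨this.1.1, this.1.2, this.2⟩
          have hdB : ∀ B' ∈ 𝓑, Disjoint B B' := fun B' h' =>
            Finset.disjoint_left.2 fun C hC hC' =>
              (hB' C hC).2.1 (Finset.mem_biUnion.2 ⟨B', h', hC'⟩)
          have hBn : B ∉ 𝓑 := by
            intro hmem
            have h0 := hdB B hmem
            rw [disjoint_self, Finset.bot_eq_empty] at h0
            have := hb i
            rw [← hBc, h0] at this
            simp at this
          have := hmax (insert B 𝓑) ⟨?_, ?_, ?_⟩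
          · rw [Finset.card_insert_of_notMem hBn] at this
            omega
          · intro B' h'
            rcases Finset.mem_insert.1 h' with rfl | h'
            · exact Finset.mem_powerset.2 fun C hC => (hB' C hC).1
            · exact hsub h'
          · intro B' h'
            rcases Finset.mem_insert.1 h' with rfl | h'
            · exact ⟨hBc, W, hWi, fun C hC => (hB' C hC).2.2⟩
            · exact hbuck B' h'
          · intro B₁ h₁ B₂ h₂ hne
            rcases Finset.mem_insert.1 h₁ with h | h <;>
              rcases Finset.mem_insert.1 h₂ with h' | h'
            · exact absurd (h.trans h'.symm) hne
            · exact h ▸ hdB _ h'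
            · exact h' ▸ (hdB _ h).symm
            · exact hdisj _ h _ h' hne
  obtain ⟨G, hGH, hGc, hG⟩ := key (k - 1) (by omega)
  have h1 : #G ≤ n * b 1 := by
    have hsub : G ⊆ (univ : Finset (Fin n)).biUnion fun v => {C ∈ G | {v} ⊆ C} := by
      intro C hC
      obtain ⟨v, hv⟩ := Finset.card_pos.1 (by rw [hH C (hGH hC)]; exact hk)
      exact Finset.mem_biUnion.2 ⟨v, Finset.mem_univ _, by simp [hC, hv]⟩
    refine (Finset.card_le_card hsub).trans (Finset.card_biUnion_le.trans ?_)
    refine (Finset.sum_le_card_nsmul _ _ (b 1) fun v _ => ?_).trans (by simp)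
    have := hG {v} (by rw [Finset.card_singleton]; omega)
    rw [Finset.card_singleton] at this
    exact this.le
  have h2 : (#G : ℝ) ≤ n * b 1 := by exact_mod_cast h1
  linarith

/-- In a bucket with centre `U` in which the degrees are bounded by `b`, the remainder of a fixed
hyperedge meets the other remainders in few vertices on average. -/
theorem sum_pow_bucket_le {n i r f : ℕ} (B : Finset (Finset (Fin n))) (U : Finset (Fin n))
    (hU : #U = i) (hUB : ∀ C ∈ B, U ⊆ C) (b : ℕ → ℕ) (hBc : #B ≤ b i)
    (hdeg : ∀ W : Finset (Fin n), i < #W → #{C ∈ B | W ⊆ C} ≤ b #W)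
    (R : Finset (Fin n)) (hR : #R = r) (hRU : Disjoint U R) (θ : ℝ) (h0 : 0 ≤ θ) (τ : ℕ)
    (hτ : ∀ j ≤ r, b (i + j) * θ ^ (f - j) ≤ τ) :
    ∑ C ∈ B, θ ^ (f - #((C \ U) ∩ R)) ≤ (2 ^ r * τ : ℕ) := by
  rw [← Finset.sum_fiberwise_of_maps_to (t := R.powerset) (g := fun C => (C \ U) ∩ R)
    (fun C _ => Finset.mem_powerset.2 Finset.inter_subset_right)]
  have key : ∀ Z ∈ R.powerset,
      ∑ C ∈ B with (C \ U) ∩ R = Z, θ ^ (f - #((C \ U) ∩ R)) ≤ τ := by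
    intro Z hZ
    rw [Finset.mem_powerset] at hZ
    have h1 : ∑ C ∈ B with (C \ U) ∩ R = Z, θ ^ (f - #((C \ U) ∩ R)) =
        #{C ∈ B | (C \ U) ∩ R = Z} * θ ^ (f - #Z) := by
      rw [← nsmul_eq_mul]
      refine Finset.sum_eq_card_nsmul fun C hC => ?_
      rw [(Finset.mem_filter.1 hC).2]
    rw [h1]
    refine le_trans (mul_le_mul_of_nonneg_right (Nat.cast_le.2 ?_) (by positivity))
      (hτ #Z (hR ▸ Finset.card_le_card hZ))
    have hUZ : #(U ∪ Z) = i + #Z := by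
      rw [Finset.card_union_of_disjoint (hRU.mono_right hZ), hU]
    rcases Nat.eq_zero_or_pos #Z with hz | hz
    · rw [hz]
      exact (Finset.card_le_card (Finset.filter_subset _ _)).trans hBc
    · rw [← hUZ]
      refine le_trans (Finset.card_le_card fun C hC => ?_) (hdeg (U ∪ Z) (by omega))
      obtain ⟨hCB, rfl⟩ := Finset.mem_filter.1 hC
      refine Finset.mem_filter.2 ⟨hCB, Finset.union_subset (hUB C hCB) ?_⟩
      exact Finset.inter_subset_left.trans Finset.sdiff_subset
  refine (Finset.sum_le_card_nsmul _ _ _ key).trans (le_of_eq ?_)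
  rw [Finset.card_powerset, hR, nsmul_eq_mul]
  push_cast
  ring

theorem card_sdiff_le_card_disjSum_sdiff {α β : Type*} [DecidableEq α] [DecidableEq β]
    (s s' : Finset α) (t t' : Finset β) :
    #(s \ s') ≤ #(s.disjSum t \ s'.disjSum t') ∧ #(t \ t') ≤ #(s.disjSum t \ s'.disjSum t') := by
  constructor
  · rw [← Finset.card_map Function.Embedding.inl]
    refine Finset.card_le_card fun x hx => ?_
    obtain ⟨a, ha, rfl⟩ := Finset.mem_map.1 hx
    simpa using ha
  · rw [← Finset.card_map Function.Embedding.inr]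
    refine Finset.card_le_card fun x hx => ?_
    obtain ⟨a, ha, rfl⟩ := Finset.mem_map.1 hx
    simpa using ha

/-- A nonzero vector supported on `H` in the kernel of the incidence map is an even cover. -/
theorem exists_isEvenCover_of_kernel {n : ℕ} (H : Finset (Finset (Fin n)))
    (x : Finset (Fin n) → ZMod 2) (hx : x ≠ 0) (hH : ∀ C, C ∉ H → x C = 0)
    (hker : Fintype.linearCombination (ZMod 2) (fun C : Finset (Fin n) => indVec C) x = 0) :
    ∃ E, IsEvenCover H E ∧ #E = hammingNorm x := by
  refine ⟨({C | x C ≠ 0} : Finset _), ⟨fun C hC => ?_, ?_, fun v => ?_⟩, rfl⟩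
  · by_contra h
    exact (Finset.mem_filter.1 hC).2 (hH C h)
  · obtain ⟨C, hC⟩ := Function.ne_iff.1 hx
    exact ⟨C, by simpa using hC⟩
  · have h1 := congrFun hker v
    rw [Fintype.linearCombination_apply, Finset.sum_apply] at h1
    rw [← ZMod.natCast_eq_zero_iff_even, Finset.filter_filter, Finset.natCast_card_filter]
    refine Eq.trans (Finset.sum_congr rfl fun C _ => ?_) h1
    have h2 : ∀ y : ZMod 2, y ≠ 0 → y = 1 := by decide
    by_cases hv : v ∈ C
    · by_cases hC : x C = 0
      · simp [hC]
      · simp [indVec, hv, h2 _ hC]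
    · simp [indVec, hv]

theorem sub_card_inter_le_card_sdiff {α : Type*} [DecidableEq α] {R R' S S' : Finset α} {f : ℕ}
    (hS : S ⊆ R) (hS' : S' ⊆ R') (hf : f ≤ #S') : f - #(R' ∩ R) ≤ #(S' \ S) := by
  have h1 := Finset.card_sdiff_add_card_inter S' S
  have h2 := Finset.card_le_card (Finset.inter_subset_inter hS' hS)
  omega

theorem indVec_disjSum {α β : Type*} [DecidableEq α] [DecidableEq β] (s : Finset α)
    (t : Finset β) :
    indVec (s.disjSum ∅) + indVec ((∅ : Finset α).disjSum t) = indVec (s.disjSum t) := by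
  ext (a | b) <;> simp [indVec]

theorem indVec_sdiff {X : Type*} [DecidableEq X] {S U : Finset X} (h : U ⊆ S) :
    indVec (S \ U) = indVec S + indVec U := by
  rw [← indVec_symmDiff, symmDiff_of_ge h]

open Classical in
/-- Sufficiently many hyperedges arranged in disjoint buckets force a short even cover. -/
theorem exists_isEvenCover_of_buckets {n k i r a ℓ : ℕ} (H : Finset (Finset (Fin n)))
    (hH : ∀ C ∈ H, #C = k) (hk : k = i + r) (hr : r ≤ ℓ) (b : ℕ → ℕ) (ha : b i = 2 * a)
    (𝓑 : Finset (Finset (Finset (Fin n)))) (h𝓑 : ∀ B ∈ 𝓑, B ⊆ H ∧ IsBucket i (b i) B)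
    (hdisj : ∀ B ∈ 𝓑, ∀ B' ∈ 𝓑, B ≠ B' → Disjoint B B')
    (hdeg : ∀ B ∈ 𝓑, ∀ W : Finset (Fin n), i < #W → #{C ∈ B | W ⊆ C} ≤ b #W)
    (θ : ℝ) (h0 : 0 ≤ θ) (h1 : θ ≤ 1) (hθ : ((ℓ - r : ℕ) : ℝ) ≤ θ * (n + n - r - r : ℕ)) (τ : ℕ)
    (hτ : ∀ j ≤ r, b (i + j) * θ ^ (r / 2 - j) ≤ τ)
    (hbig : 4 * (4 * (32 * (2 ^ r * τ)) * Nat.log 2 ((n + n).choose ℓ) + 1) * (n + n).choose ℓ <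
      #𝓑 * (a * a) * (n + n - r - r).choose (ℓ - r)) :
    ∃ E, IsEvenCover H E ∧ #E ≤ 4 * (Nat.log 2 ((n + n).choose ℓ) + 1) := by
  have hU : ∀ B : Finset (Finset (Fin n)), ∃ U : Finset (Fin n),
      B ∈ 𝓑 → #U = i ∧ ∀ C ∈ B, U ⊆ C := by
    intro B
    by_cases hB : B ∈ 𝓑
    · obtain ⟨U, hU⟩ := (h𝓑 B hB).2.2
      exact ⟨U, fun _ => hU⟩
    · exact ⟨∅, fun h => absurd h hB⟩
  choose U hU using hU
  have hl : ∀ B : Finset (Finset (Fin n)), ∃ L ⊆ B, B ∈ 𝓑 → #L = a := by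
    intro B
    by_cases hB : B ∈ 𝓑
    · obtain ⟨L, hL, hLa⟩ := Finset.exists_subset_card_eq (s := B) (n := a)
        (by rw [(h𝓑 B hB).2.1]; omega)
      exact ⟨L, hL, fun _ => hLa⟩
    · exact ⟨∅, Finset.empty_subset _, fun h => absurd h hB⟩
  choose L hLB hLa using hl
  have huniq : ∀ {B B' C}, B ∈ 𝓑 → B' ∈ 𝓑 → C ∈ B → C ∈ B' → B = B' := by
    intro B B' C hB hB' hC hC'
    by_contra hne
    exact Finset.disjoint_left.1 (hdisj B hB B' hB' hne) hC hC'
  have hR : ∀ C : Finset (Fin n), ∃ R, ∀ B ∈ 𝓑, C ∈ B → R = C \ U B := by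
    intro C
    by_cases hC : ∃ B ∈ 𝓑, C ∈ B
    · obtain ⟨B, hB, hCB⟩ := hC
      exact ⟨C \ U B, fun B' hB' hC' => by rw [huniq hB hB' hCB hC']⟩
    · exact ⟨∅, fun B hB hCB => absurd ⟨B, hB, hCB⟩ hC⟩
  choose R hR using hR
  have hRr : ∀ {B C}, B ∈ 𝓑 → C ∈ B → #(R C) = r := by
    intro B C hB hC
    rw [hR C B hB hC, Finset.card_sdiff_of_subset ((hU B hB).2 C hC), (hU B hB).1,
      hH C ((h𝓑 B hB).1 hC), hk]
    omega
  have hS : ∀ C : Finset (Fin n), ∃ S ⊆ R C, #S = #(R C) / 2 := fun C =>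
    Finset.exists_subset_card_eq (Nat.div_le_self _ _)
  choose S hSR hSr using hS
  let Q : Finset (Finset (Fin n) × Finset (Fin n)) := 𝓑.biUnion fun B => L B ×ˢ (B \ L B)
  have hQ : ∀ p ∈ Q, ∃ B ∈ 𝓑, p.1 ∈ L B ∧ p.1 ∈ B ∧ p.2 ∈ B ∧ p.2 ∉ L B := by
    intro p hp
    obtain ⟨B, hB, hp⟩ := Finset.mem_biUnion.1 hp
    rw [Finset.mem_product, Finset.mem_sdiff] at hp
    exact ⟨B, hB, hp.1, hLB B hp.1, hp.2.1, hp.2.2⟩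
  have hQc : #Q = #𝓑 * (a * a) := by
    rw [Finset.card_biUnion]
    · refine Finset.sum_const_nat fun B hB => ?_
      rw [Finset.card_product, Finset.card_sdiff_of_subset (hLB B), hLa B hB, (h𝓑 B hB).2.1, ha]
      congr 1
      omega
    · intro B hB B' hB' hne
      refine Finset.disjoint_left.2 fun p hp hp' => ?_
      rw [Finset.mem_product] at hp hp'
      exact hne (huniq hB hB' (hLB B hp.1) (hLB B' hp'.1))
  let v : Finset (Fin n) → Finset (Fin n ⊕ Fin n) := fun C =>
    if ∃ B ∈ 𝓑, C ∈ L B then (R C).disjSum ∅ else (∅ : Finset (Fin n)).disjSum (R C)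
  have hnL : ∀ p ∈ Q, ¬ ∃ B ∈ 𝓑, p.2 ∈ L B := by
    rintro p hp ⟨B', hB', hpL⟩
    obtain ⟨B, hB, -, -, h3, h4⟩ := hQ p hp
    exact h4 (huniq hB hB' h3 (hLB B' hpL) ▸ hpL)
  have hv₁ : ∀ p ∈ Q, v p.1 = (R p.1).disjSum ∅ := by
    intro p hp
    obtain ⟨B, hB, h2, -, -, -⟩ := hQ p hp
    exact if_pos ⟨B, hB, h2⟩
  have hv₂ : ∀ p ∈ Q, v p.2 = (∅ : Finset (Fin n)).disjSum (R p.2) := fun p hp =>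
    if_neg (hnL p hp)
  let φ := Fintype.linearCombination (ZMod 2) fun C => indVec (v C)
  let Φ := Fintype.linearCombination (ZMod 2) fun C : Finset (Fin n) => indVec C
  let fold : (Fin n ⊕ Fin n → ZMod 2) →ₗ[ZMod 2] (Fin n → ZMod 2) :=
    LinearMap.funLeft (ZMod 2) (ZMod 2) Sum.inl + LinearMap.funLeft (ZMod 2) (ZMod 2) Sum.inr
  let K : Submodule (ZMod 2) (Finset (Fin n) → ZMod 2) :=
    LinearMap.eqLocus Φ (fold ∘ₗ φ) ⊓ Submodule.pi (H : Set (Finset (Fin n)))ᶜ fun _ => ⊥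
  let A : Finset (Fin n) × Finset (Fin n) → Finset (Fin n ⊕ Fin n) := fun p =>
    (S p.1).disjSum (R p.2 \ S p.2)
  let A' : Finset (Fin n) × Finset (Fin n) → Finset (Fin n ⊕ Fin n) := fun p =>
    (R p.1 \ S p.1).disjSum (S p.2)
  have hφ : ∀ p ∈ Q, φ (Pi.single p.1 1 + Pi.single p.2 1) =
      indVec ((R p.1).disjSum (R p.2)) := by
    intro p hp
    rw [map_add, Fintype.linearCombination_apply_single, Fintype.linearCombination_apply_single,
      one_smul, one_smul, hv₁ p hp, hv₂ p hp, indVec_disjSum]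
  have hAA : ∀ p, A p ∪ A' p = (R p.1).disjSum (R p.2) := by
    intro p
    ext (x | x)
    · have := @hSR p.1 x
      simp only [A, A', Finset.mem_union, Finset.inl_mem_disjSum, Finset.mem_sdiff]
      tauto
    · have := @hSR p.2 x
      simp only [A, A', Finset.mem_union, Finset.inr_mem_disjSum, Finset.mem_sdiff]
      tauto
  have hSc : ∀ {B C}, B ∈ 𝓑 → C ∈ B → #(S C) = r / 2 ∧ #(R C \ S C) = r - r / 2 := by
    intro B C hB hC
    have h1 := hSr C
    rw [hRr hB hC] at h1
    exact ⟨h1, by rw [Finset.card_sdiff_of_subset (hSR C), hRr hB hC, h1]⟩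
  have hsum : ∀ (D : Finset (Fin n) × Finset (Fin n) → Finset (Fin n ⊕ Fin n))
      (g g' : Finset (Fin n) × Finset (Fin n) → Finset (Fin n)),
      (∀ p p', g p = g p' → g' p = g' p' → p = p') →
      (∀ p ∈ Q, ∃ B ∈ 𝓑, g p ∈ B ∧ g' p ∈ B) →
      (∀ p ∈ Q, ∀ p' ∈ Q, r / 2 - #(R (g' p') ∩ R (g' p)) ≤ #(D p' \ D p)) →
      ∀ p ∈ Q, ∑ p' ∈ Q with g p' = g p, θ ^ #(D p' \ D p) ≤ (2 ^ r * τ : ℕ) := by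
    intro D g g' hinj hgB hD p hp
    obtain ⟨B, hB, hg, hg'⟩ := hgB p hp
    have hin : ∀ p' ∈ Q, g p' = g p → g' p' ∈ B := by
      intro p' hp' he
      obtain ⟨B', hB', h3, h4⟩ := hgB p' hp'
      rw [he] at h3
      exact huniq hB hB' hg h3 ▸ h4
    calc ∑ p' ∈ Q with g p' = g p, θ ^ #(D p' \ D p)
        ≤ ∑ p' ∈ Q with g p' = g p, θ ^ (r / 2 - #((g' p' \ U B) ∩ R (g' p))) := by
          refine Finset.sum_le_sum fun p' hp' => ?_
          rw [Finset.mem_filter] at hp'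
          refine pow_le_pow_of_le_one h0 h1 ?_
          rw [← hR _ B hB (hin p' hp'.1 hp'.2)]
          exact hD p hp p' hp'.1
      _ = ∑ C ∈ ({p' ∈ Q | g p' = g p} : Finset _).image g',
            θ ^ (r / 2 - #((C \ U B) ∩ R (g' p))) := by
          rw [Finset.sum_image]
          intro p₁ hp₁ p₂ hp₂ he
          rw [Finset.mem_coe, Finset.mem_filter] at hp₁ hp₂
          exact hinj _ _ (hp₁.2.trans hp₂.2.symm) he
      _ ≤ ∑ C ∈ B, θ ^ (r / 2 - #((C \ U B) ∩ R (g' p))) := by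
          refine Finset.sum_le_sum_of_subset_of_nonneg ?_ fun _ _ _ => by positivity
          intro C hC
          obtain ⟨p', hp', rfl⟩ := Finset.mem_image.1 hC
          rw [Finset.mem_filter] at hp'
          exact hin p' hp'.1 hp'.2
      _ ≤ _ := by
          refine sum_pow_bucket_le B (U B) (hU B hB).1 (hU B hB).2 b (h𝓑 B hB).2.1.le
            (hdeg B hB) _ (hRr hB hg') ?_ θ h0 τ hτ
          rw [hR _ B hB hg']
          exact Finset.disjoint_sdiff
  have hg₁ : ∀ p ∈ Q, ∃ B ∈ 𝓑, p.1 ∈ B ∧ p.2 ∈ B := fun p hp => by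
    obtain ⟨B, hB, -, h2, h3, -⟩ := hQ p hp
    exact ⟨B, hB, h2, h3⟩
  have hg₂ : ∀ p ∈ Q, ∃ B ∈ 𝓑, p.2 ∈ B ∧ p.1 ∈ B := fun p hp => by
    obtain ⟨B, hB, h2, h3⟩ := hg₁ p hp
    exact ⟨B, hB, h3, h2⟩
  have hlow₁ : ∀ p ∈ Q, r / 2 ≤ #(S p.1) ∧ r / 2 ≤ #(R p.1 \ S p.1) := fun p hp => by
    obtain ⟨B, hB, h2, h3⟩ := hg₁ p hp
    have := hSc hB h2
    omega
  have hlow₂ : ∀ p ∈ Q, r / 2 ≤ #(S p.2) ∧ r / 2 ≤ #(R p.2 \ S p.2) := fun p hp => by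
    obtain ⟨B, hB, h2, h3⟩ := hg₁ p hp
    have := hSc hB h3
    omega
  have hcard : Fintype.card (Fin n ⊕ Fin n) = n + n := by simp
  rw [← hcard] at hθ hbig ⊢
  rw [← hQc] at hbig
  have hker : ∃ x ∈ K, x ≠ 0 ∧ φ x = 0 ∧ hammingNorm x ≤
      4 * (Nat.log 2 ((Fintype.card (Fin n ⊕ Fin n)).choose ℓ) + 1) := by
    refine exists_short_kernel_vector_of_pairs Q A A' φ K
      (fun p hp => by rw [hφ p hp, hAA])
      (fun p hp => ?_)
      (fun p hp p' hp' he => ?_) ℓ r hr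
      (fun p hp => ?_) (fun p hp => ?_) (fun p hp => ?_) θ h0 h1 hθ (2 ^ r * τ)
      (hsum A Prod.fst Prod.snd (fun _ _ => Prod.ext) hg₁ fun p hp p' hp' =>
        (sub_card_inter_le_card_sdiff Finset.sdiff_subset Finset.sdiff_subset (hlow₂ p' hp').2).trans
          (card_sdiff_le_card_disjSum_sdiff _ _ _ _).2)
      (hsum A Prod.snd Prod.fst (fun _ _ h h' => Prod.ext h' h) hg₂ fun p hp p' hp' =>
        (sub_card_inter_le_card_sdiff (hSR _) (hSR _) (hlow₁ p' hp').1).trans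
          (card_sdiff_le_card_disjSum_sdiff _ _ _ _).1)
      (hsum A' Prod.fst Prod.snd (fun _ _ => Prod.ext) hg₁ fun p hp p' hp' =>
        (sub_card_inter_le_card_sdiff (hSR _) (hSR _) (hlow₂ p' hp').1).trans
          (card_sdiff_le_card_disjSum_sdiff _ _ _ _).2)
      (hsum A' Prod.snd Prod.fst (fun _ _ h h' => Prod.ext h' h) hg₂ fun p hp p' hp' =>
        (sub_card_inter_le_card_sdiff Finset.sdiff_subset Finset.sdiff_subset (hlow₁ p' hp').2).trans
          (card_sdiff_le_card_disjSum_sdiff _ _ _ _).1)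
      hbig
    · obtain ⟨B, hB, h2, h3⟩ := hg₁ p hp
      refine ⟨LinearMap.mem_eqLocus.2 ?_, ?_⟩
      · rw [LinearMap.comp_apply, hφ p hp, map_add, Fintype.linearCombination_apply_single,
          Fintype.linearCombination_apply_single, one_smul, one_smul]
        have h4 : fold (indVec ((R p.1).disjSum (R p.2))) = indVec (R p.1) + indVec (R p.2) := by
          ext y
          simp [fold, indVec, LinearMap.funLeft_apply]
        rw [h4, hR _ B hB h2, hR _ B hB h3, indVec_sdiff ((hU B hB).2 _ h2),
          indVec_sdiff ((hU B hB).2 _ h3), add_add_add_comm, ZModModule.add_self, add_zero]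
      · intro C hC
        have h5 : ∀ D ∈ B, C ≠ D := by
          rintro D hD rfl
          exact hC ((h𝓑 B hB).1 hD)
        refine (Submodule.mem_bot (ZMod 2)).2 ?_
        rw [Pi.add_apply, Pi.single_eq_of_ne (h5 _ h2), Pi.single_eq_of_ne (h5 _ h3), add_zero]
    · obtain ⟨B, hB, h2, -⟩ := hQ p hp
      exact hnL p' hp' ⟨B, hB, he ▸ h2⟩
    · obtain ⟨B, hB, h2, h3⟩ := hg₁ p hp
      rw [Finset.card_disjSum, (hSc hB h2).1, (hSc hB h3).2]
      omega
    · obtain ⟨B, hB, h2, h3⟩ := hg₁ p hp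
      rw [Finset.card_disjSum, (hSc hB h2).2, (hSc hB h3).1]
      omega
    · rw [Finset.disjoint_left]
      rintro (y | y) hy hy'
      · simp only [A, A', Finset.inl_mem_disjSum, Finset.mem_sdiff] at hy hy'
        exact hy'.2 hy
      · simp only [A, A', Finset.inr_mem_disjSum, Finset.mem_sdiff] at hy hy'
        exact hy.2 hy'
  obtain ⟨x, hxK, hx0, hφx, hxc⟩ := hker
  obtain ⟨hx₁, hx₂⟩ := hxK
  have hΦ : Φ x = 0 := by
    have := LinearMap.mem_eqLocus.1 hx₁
    rw [this, LinearMap.comp_apply, hφx, map_zero]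
  obtain ⟨E, hE, hEc⟩ := exists_isEvenCover_of_kernel H x hx0
    (fun C hC => hx₂ C (by simpa using hC)) hΦ
  exact ⟨E, hE, hEc ▸ hxc⟩

/-- A lower bound for a binomial coefficient with both arguments decreased. -/
theorem pow_mul_choose_le_choose_sub_sub {β : ℝ} (hβ : 0 ≤ β) (r : ℕ) :
    ∀ M L : ℕ, β * M ≤ L - r → r ≤ M → β ^ r * M.choose L ≤ (M - r).choose (L - r) := by
  induction r with
  | zero => intro M L _ _; simp
  | succ r ih =>
    intro M L hL hM
    have hM0 : (0 : ℝ) ≤ β * M := by positivity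
    have hr : r + 1 ≤ L := by
      push_cast at hL
      exact_mod_cast (by linarith : (r : ℝ) + 1 ≤ L)
    obtain ⟨L, rfl⟩ : ∃ L', L = L' + 1 := ⟨L - 1, by omega⟩
    obtain ⟨M, rfl⟩ : ∃ M', M = M' + 1 := ⟨M - 1, by omega⟩
    rw [Nat.add_sub_add_right, Nat.add_sub_add_right]
    push_cast at hL
    refine le_trans ?_ (ih M L (by linarith) (by omega))
    rw [pow_succ, mul_assoc]
    refine mul_le_mul_of_nonneg_left ?_ (by positivity)
    have h2 : ((M : ℝ) + 1) * (M.choose L : ℕ) = ((M + 1).choose (L + 1) : ℕ) * ((L : ℝ) + 1) := by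
      exact_mod_cast Nat.add_one_mul_choose_eq M L
    have hM' : (0 : ℝ) < M + 1 := by positivity
    refine le_of_mul_le_mul_left ?_ hM'
    rw [h2]
    have h3 : (0 : ℝ) ≤ ((M + 1).choose (L + 1) : ℕ) := Nat.cast_nonneg _
    have h4 : (0 : ℝ) ≤ r := Nat.cast_nonneg _
    nlinarith

/-- A lower bound for a binomial coefficient with the upper argument decreased. -/
theorem pow_mul_choose_le_choose_sub {β : ℝ} (hβ : 0 ≤ β) (L r : ℕ) :
    ∀ M : ℕ, β * M ≤ M - L - r → β ^ r * M.choose L ≤ (M - r).choose L := by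
  induction r with
  | zero => intro M _; simp
  | succ r ih =>
    intro M hM
    have hM0 : (0 : ℝ) ≤ β * M := by positivity
    have hr : L + r + 1 ≤ M := by
      push_cast at hM
      exact_mod_cast (by linarith : (L : ℝ) + r + 1 ≤ M)
    obtain ⟨M, rfl⟩ : ∃ M', M = M' + 1 := ⟨M - 1, by omega⟩
    rw [Nat.add_sub_add_right]
    push_cast at hM
    refine le_trans ?_ (ih M (by linarith))
    rw [pow_succ, mul_assoc]
    refine mul_le_mul_of_nonneg_left ?_ (by positivity)
    have h2 : (M.choose L : ℝ) * (M + 1) = (M + 1).choose L * ((M : ℝ) + 1 - L) := by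
      rw [← Nat.cast_add_one M, ← Nat.cast_sub (by omega : L ≤ M + 1)]
      exact_mod_cast Nat.choose_mul_succ_eq M L
    have hM' : (0 : ℝ) < M + 1 := by positivity
    refine le_of_mul_le_mul_right ?_ hM'
    rw [h2]
    have h3 : (0 : ℝ) ≤ ((M + 1).choose L : ℕ) := Nat.cast_nonneg _
    have h4 : (0 : ℝ) ≤ r := Nat.cast_nonneg _
    nlinarith

theorem pow_mul_choose_le_choose_window {n ℓ r : ℕ} (hr : 2 * r ≤ ℓ) (hℓ : ℓ ≤ n) :
    ((ℓ : ℝ) / n / 16) ^ r * (n + n).choose ℓ ≤ (n + n - r - r).choose (ℓ - r) := by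
  rcases Nat.eq_zero_or_pos n with rfl | hn
  · obtain rfl : ℓ = 0 := by omega
    obtain rfl : r = 0 := by omega
    simp
  have hn' : (0 : ℝ) < n := by exact_mod_cast hn
  have hr' : 2 * (r : ℝ) ≤ ℓ := by exact_mod_cast hr
  have hℓ' : (ℓ : ℝ) ≤ n := by exact_mod_cast hℓ
  have h1 := pow_mul_choose_le_choose_sub_sub (β := (ℓ : ℝ) / n / 4) (by positivity) r (n + n) ℓ
    (by
      have : (ℓ : ℝ) / n / 4 * (n + n : ℕ) = ℓ / 2 := by
        push_cast
        field_simp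
        ring
      linarith) (by omega)
  have h2 := pow_mul_choose_le_choose_sub (β := 1 / 4) (by norm_num) (ℓ - r) r (n + n - r)
    (by
      rw [Nat.cast_sub (by omega : r ≤ n + n), Nat.cast_sub (by omega : r ≤ ℓ)]
      push_cast
      linarith)
  calc ((ℓ : ℝ) / n / 16) ^ r * (n + n).choose ℓ
      = (1 / 4) ^ r * (((ℓ : ℝ) / n / 4) ^ r * (n + n).choose ℓ) := by
        rw [← mul_assoc, ← mul_pow]
        congr 2
        ring
    _ ≤ (1 / 4) ^ r * ((n + n - r).choose (ℓ - r) : ℕ) := by gcongr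
    _ ≤ _ := h2

theorem natLog_choose_le {n : ℕ} (hn : 2 ≤ n) (ℓ : ℕ) :
    (Nat.log 2 ((n + n).choose ℓ) : ℝ) ≤ 2 * ℓ * Real.logb 2 n := by
  have h1 : (n + n).choose ℓ ≤ n ^ (2 * ℓ) :=
    (Nat.choose_le_pow _ _).trans (by
      rw [pow_mul]
      exact Nat.pow_le_pow_left (by nlinarith) _)
  calc (Nat.log 2 ((n + n).choose ℓ) : ℝ) ≤ (Nat.log 2 (n ^ (2 * ℓ)) : ℕ) := by
        exact_mod_cast Nat.log_mono_right h1
    _ ≤ Real.logb 2 ((n ^ (2 * ℓ) : ℕ) : ℝ) := by exact_mod_cast Real.natLog_le_logb _ _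
    _ = 2 * ℓ * Real.logb 2 n := by
        rw [Nat.cast_pow, Real.logb_pow]
        push_cast
        ring

open Classical in
/-- A hypergraph satisfying the density condition contains an even cover of
length `O(ℓ log n)`. -/
theorem exists_isEvenCover_of_dense {k n ℓ : ℕ} (H : Finset (Finset (Fin n))) (hk : 2 ≤ k)
    (hkℓ : 2 * (k - 1) ≤ ℓ) (hℓn : ℓ ≤ n) (hH : ∀ C ∈ H, #C = k)
    (hd : (2 ^ 15 : ℝ) ^ k * n * ((n : ℝ) / ℓ) ^ ((k : ℝ) / 2 - 1) * Real.logb 2 n ≤ #H) :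
    ∃ E, IsEvenCover H E ∧ (#E : ℝ) ≤ 12 * ℓ * Real.logb 2 n := by
  have hℓ0 : (0 : ℝ) < ℓ := by exact_mod_cast (by omega : 0 < ℓ)
  have hn0 : (0 : ℝ) < n := by exact_mod_cast (by omega : 0 < n)
  have hk0 : (0 : ℝ) < k := by exact_mod_cast (by omega : 0 < k)
  have hk2 : (2 : ℝ) ≤ k := by exact_mod_cast hk
  have hℓ1 : (1 : ℝ) ≤ ℓ := by exact_mod_cast (by omega : 1 ≤ ℓ)
  set ρ : ℝ := n / ℓ with hρ
  have hρ1 : 1 ≤ ρ := by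
    rw [hρ, one_le_div hℓ0]
    exact_mod_cast hℓn
  have hρ0 : 0 < ρ := by positivity
  set lg : ℝ := Real.logb 2 n with hlg
  have hlg1 : 1 ≤ lg := by
    rw [hlg, Real.le_logb_iff_rpow_le (by norm_num) hn0, Real.rpow_one]
    exact_mod_cast (by omega : 2 ≤ n)
  set σ : ℝ := ρ ^ ((k : ℝ) / 2 - 1) with hσ
  have hσ1 : 1 ≤ σ := Real.one_le_rpow hρ1 (by linarith)
  let a : ℕ → ℕ := fun i : ℕ => ⌈ρ ^ ((k : ℝ) / 2 - i)⌉₊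
  have ha0 : ∀ i, 0 < a i := fun i => Nat.ceil_pos.2 (by positivity)
  have hale : ∀ i : ℕ, (a i : ℝ) ≤ ρ ^ ((k : ℝ) / 2 - i) + 1 := fun i =>
    (Nat.ceil_lt_add_one (by positivity)).le
  have hage : ∀ i : ℕ, ρ ^ ((k : ℝ) / 2 - i) ≤ a i := fun i => Nat.le_ceil _
  have hΓ : (2 ^ 15 : ℝ) * 2 ^ k * 16 ^ k * k < (2 ^ 15) ^ k := by
    have h1 : (k : ℝ) < 2 ^ k := by exact_mod_cast Nat.lt_two_pow_self
    have h2 : (2 ^ 15 : ℝ) ≤ (2 ^ 9) ^ k := by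
      rw [← pow_mul]
      exact pow_le_pow_right₀ (by norm_num) (by omega)
    calc (2 ^ 15 : ℝ) * 2 ^ k * 16 ^ k * k < 2 ^ 15 * 2 ^ k * 16 ^ k * 2 ^ k := by gcongr
      _ ≤ (2 ^ 9) ^ k * 2 ^ k * 16 ^ k * 2 ^ k := by gcongr
      _ = (2 ^ 15) ^ k := by
        rw [← mul_pow, ← mul_pow, ← mul_pow]
        norm_num
  obtain ⟨i, hi0, hik, 𝓑, h𝓑, hdisj, hdeg, hg⟩ := exists_buckets H (by omega) hH
    (fun i => 2 * a i) (fun i => by have := ha0 i; omega) ((#H : ℝ) / (2 * k)) (by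
      have h1 : (a 1 : ℝ) ≤ 2 * σ := by
        have := hale 1
        rw [Nat.cast_one, ← hσ] at this
        linarith
      have h2 : ((k - 1 : ℕ) : ℝ) * (#H / (2 * k)) ≤ #H / 2 := by
        have : ((k - 1 : ℕ) : ℝ) ≤ k := by exact_mod_cast Nat.sub_le k 1
        calc ((k - 1 : ℕ) : ℝ) * (#H / (2 * k)) ≤ k * (#H / (2 * k)) := by gcongr
          _ = #H / 2 := by field_simp
      have h3 : (8 : ℝ) < (2 ^ 15) ^ k := by
        refine lt_of_le_of_lt ?_ hΓ
        have : (1 : ℝ) ≤ 2 ^ k * 16 ^ k * k := by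
          rw [← mul_pow]
          exact one_le_mul_of_one_le_of_one_le (one_le_pow₀ (by norm_num)) (by linarith)
        nlinarith
      have h4 : 8 * (n * σ) < #H :=
        calc 8 * (n * σ) < (2 ^ 15) ^ k * (n * σ) := by gcongr
          _ ≤ (2 ^ 15) ^ k * (n * σ) * lg := le_mul_of_one_le_right (by positivity) hlg1
          _ ≤ #H := by rw [← mul_assoc]; exact hd
      have h5 : (n : ℝ) * a 1 ≤ n * (2 * σ) := by gcongr
      push_cast
      linarith)
  set r := k - i with hr
  have hr2 : 2 * r ≤ ℓ := by omega
  have hrk : (r : ℝ) = k - i := by rw [hr, Nat.cast_sub hik.le]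
  have hi1 : (1 : ℝ) ≤ i := by exact_mod_cast hi0
  have hθ : (ℓ : ℝ) / n = ρ⁻¹ := by rw [hρ, inv_div]
  have hlogN := natLog_choose_le (n := n) (by omega) ℓ
  rw [← hlg] at hlogN
  obtain ⟨E, hE, hEc⟩ := exists_isEvenCover_of_buckets (ℓ := ℓ) H hH (by omega : k = i + r)
    (by omega) (fun i => 2 * a i) rfl 𝓑 h𝓑 hdisj hdeg ((ℓ : ℝ) / n) (by positivity)
    (by rw [div_le_one hn0]; exact_mod_cast hℓn)
    (by
      calc ((ℓ - r : ℕ) : ℝ) ≤ ℓ := by exact_mod_cast Nat.sub_le ℓ r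
        _ = ℓ / n * n := by field_simp
        _ ≤ ℓ / n * (n + n - r - r : ℕ) := by
          gcongr
          omega)
    4
    (by
      intro j _
      rw [hθ, inv_pow, ← Real.rpow_natCast, ← Real.rpow_neg hρ0.le]
      have hs : ((r : ℝ) - 1) / 2 - j ≤ ((r / 2 - j : ℕ) : ℝ) := by
        have : r ≤ 2 * (r / 2 - j) + 2 * j + 1 := by omega
        have : (r : ℝ) ≤ 2 * (r / 2 - j : ℕ) + 2 * j + 1 := by exact_mod_cast this
        linarith
      set s : ℝ := ((r / 2 - j : ℕ) : ℝ)
      have h1 : ρ ^ (-s) ≤ 1 := Real.rpow_le_one_of_one_le_of_nonpos hρ1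
        (neg_nonpos.2 (Nat.cast_nonneg _))
      have h2 : ρ ^ ((k : ℝ) / 2 - (i + j : ℕ)) * ρ ^ (-s) ≤ 1 := by
        rw [← Real.rpow_add hρ0]
        refine Real.rpow_le_one_of_one_le_of_nonpos hρ1 ?_
        push_cast
        linarith
      have h3 : 0 ≤ ρ ^ (-s) := by positivity
      have h4 := mul_le_mul_of_nonneg_right (hale (i + j)) h3
      push_cast at h4 ⊢
      push_cast at h2
      linarith)
    (by
      set N := (n + n).choose ℓ with hN
      set Z := (n + n - r - r).choose (ℓ - r) with hZ
      have hN0 : (0 : ℝ) < N := by exact_mod_cast Nat.choose_pos (by omega)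
      have hZN : ρ ^ (-(r : ℝ)) / 16 ^ k * N ≤ Z := by
        refine le_trans ?_ (pow_mul_choose_le_choose_window hr2 hℓn)
        rw [hθ, div_pow, inv_pow, ← Real.rpow_natCast ρ, ← Real.rpow_neg hρ0.le]
        gcongr
        · norm_num
        · omega
      have hQ : (2 ^ 15 : ℝ) ^ k * n * σ * lg / (4 * k) * ρ ^ ((k : ℝ) / 2 - i) ≤
          #𝓑 * (a i * a i) := by
        have h1 : (2 ^ 15 : ℝ) ^ k * n * σ * lg / (4 * k) ≤ #𝓑 * a i := by
          have : (#H : ℝ) / (4 * k) ≤ #𝓑 * a i := by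
            have h2 : (#H : ℝ) / (4 * k) = #H / (2 * k) / 2 := by
              field_simp
              norm_num
            push_cast at hg
            linarith
          exact le_trans (by gcongr) this
        rw [← mul_assoc]
        exact mul_le_mul h1 (hage i) (by positivity) (by positivity)
      have hpow : σ * ρ ^ ((k : ℝ) / 2 - i) * ρ ^ (-(r : ℝ)) = ℓ / n := by
        rw [hσ, ← Real.rpow_add hρ0, ← Real.rpow_add hρ0, hrk, hθ, ← Real.rpow_neg_one]
        congr 1
        ring
      have h2r : (2 : ℝ) ^ r ≤ 2 ^ k := pow_le_pow_right₀ (by norm_num) (by omega)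
      have hℓlg : 1 ≤ ℓ * lg := one_le_mul_of_one_le_of_one_le hℓ1 hlg1
      have h2k : (1 : ℝ) ≤ 2 ^ k := one_le_pow₀ (by norm_num)
      have hmain : 4 * (4 * (32 * (2 ^ r * 4)) * (Nat.log 2 N : ℝ) + 1) * N <
          #𝓑 * (a i * a i) * Z :=
        calc 4 * (4 * (32 * (2 ^ r * 4)) * (Nat.log 2 N : ℝ) + 1) * N
            ≤ 4 * (4 * (32 * (2 ^ k * 4)) * (2 * ℓ * lg) + 2 ^ k * (ℓ * lg)) * N := by
              gcongr
              exact one_le_mul_of_one_le_of_one_le h2k hℓlg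
          _ = 4100 * 2 ^ k * (ℓ * lg * N) := by ring
          _ ≤ 2 ^ 13 * 2 ^ k * (ℓ * lg * N) := by gcongr; norm_num
          _ = 2 ^ 15 * 2 ^ k * 16 ^ k * k / (4 * k * 16 ^ k) * (ℓ * lg * N) := by
              congr 1
              field_simp
              norm_num
          _ < (2 ^ 15) ^ k / (4 * k * 16 ^ k) * (ℓ * lg * N) := by gcongr
          _ = (2 ^ 15) ^ k / (4 * k * 16 ^ k) * (n * (ℓ / n) * lg * N) := by
              congr 3
              field_simp
          _ = (2 ^ 15 : ℝ) ^ k * n * σ * lg / (4 * k) * ρ ^ ((k : ℝ) / 2 - i) *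
              (ρ ^ (-(r : ℝ)) / 16 ^ k * N) := by
              rw [← hpow]
              field_simp
          _ ≤ #𝓑 * (a i * a i) * Z := by gcongr
      exact_mod_cast hmain)
  refine ⟨E, hE, ?_⟩
  have h1 : (#E : ℝ) ≤ 4 * (Nat.log 2 ((n + n).choose ℓ) + 1) := by exact_mod_cast hEc
  have h2 : 1 ≤ ℓ * lg := one_le_mul_of_one_le_of_one_le hℓ1 hlg1
  nlinarith

open Classical in
/-- Greedy extraction: if every dense subfamily of `H` contains a short even cover, then `H`
contains many disjoint ones. -/
theorem exists_disjoint_isEvenCover {n : ℕ} (H : Finset (Finset (Fin n))) {h m₀ : ℝ} (hh : 0 ≤ h)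
    (hext : ∀ H' ⊆ H, m₀ ≤ #H' → ∃ E, IsEvenCover H' E ∧ (#E : ℝ) ≤ h) (hH : 2 * m₀ ≤ #H)
    (s : ℕ) (hs : s * h ≤ m₀) :
    ∃ E : Fin s → Finset (Finset (Fin n)),
      (∀ i, IsEvenCover H (E i) ∧ (#(E i) : ℝ) ≤ h) ∧
      ∀ i j, i ≠ j → Disjoint (E i) (E j) := by
  induction s with
  | zero => exact ⟨fun _ => ∅, fun i => i.elim0, fun i => i.elim0⟩
  | succ s ih =>
    push_cast at hs
    have hs' : s * h ≤ m₀ := by linarith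
    obtain ⟨E, hE, hdisj⟩ := ih hs'
    set U := (univ : Finset (Fin s)).biUnion E with hU
    have hUc : (#U : ℝ) ≤ s * h := by
      calc (#U : ℝ) ≤ ∑ i, (#(E i) : ℝ) := by exact_mod_cast Finset.card_biUnion_le
        _ ≤ ∑ _i : Fin s, h := Finset.sum_le_sum fun i _ => (hE i).2
        _ = s * h := by simp
    have hHU : (#H : ℝ) - #U ≤ #(H \ U) := by
      have h1 := Finset.le_card_sdiff U H
      have h2 : (#H : ℝ) ≤ #(H \ U) + #U := by exact_mod_cast (by omega : #H ≤ #(H \ U) + #U)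
      linarith
    obtain ⟨F, ⟨hFH, hF⟩, hFc⟩ := hext (H \ U) Finset.sdiff_subset (by linarith)
    have hFE : ∀ i, Disjoint F (E i) := fun i => Finset.disjoint_left.2 fun C hC hC' =>
      (Finset.mem_sdiff.1 (hFH hC)).2 (Finset.mem_biUnion.2 ⟨i, Finset.mem_univ _, hC'⟩)
    refine ⟨Fin.cons F E, fun i => ?_, fun i j hij => ?_⟩
    · refine Fin.cases ?_ (fun i => ?_) i
      · exact ⟨⟨hFH.trans Finset.sdiff_subset, hF⟩, hFc⟩
      · exact hE i
    · revert hij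
      refine Fin.cases ?_ (fun i => ?_) i <;> refine Fin.cases ?_ (fun j => ?_) j
      · exact fun hij => absurd rfl hij
      · exact fun _ => hFE j
      · exact fun _ => (hFE i).symm
      · exact fun hij => hdisj i j fun h => hij (congrArg Fin.succ h)

/-- There exist absolute constants `Γ > 0` and `c > 0` such that for
every `k ≥ 2` and all integers `n, ℓ` with `2(k−1) ≤ ℓ ≤ n` the following holds. Setting
`m₀ := Γ^k · n · (n/ℓ)^{k/2−1} · (log₂ n)^{4k+1}` and `h := c·ℓ·log₂ n`, every `k`-uniform
hypergraph on `[n]` with at least `2·m₀` hyperedges contains at least `⌊m₀/h⌋` pairwise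
hyperedge-disjoint even covers, each of length at most `h`. -/
theorem many_disjoint_even_covers :
    ∃ Γ c : ℝ, 0 < Γ ∧ 0 < c ∧
      ∀ (k n ℓ : ℕ) (H : Finset (Finset (Fin n))),
        2 ≤ k → 2*(k-1) ≤ ℓ → ℓ ≤ n →
        (∀ C ∈ H, C.card = k) →
        ∀ m₀ h : ℝ,
          m₀ = Γ^k * n * ((n:ℝ)/(ℓ:ℝ)) ^ ((k:ℝ)/2 - 1) * (Real.logb 2 n)^(4*k+1) →
          h = c * ℓ * Real.logb 2 n →
          2 * m₀ ≤ (H.card : ℝ) →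
          ∃ E : Fin ⌊m₀ / h⌋₊ → Finset (Finset (Fin n)),
            (∀ i, IsEvenCover H (E i) ∧ ((E i).card : ℝ) ≤ h) ∧
            (∀ i j, i ≠ j → Disjoint (E i) (E j)) := by
  refine ⟨2 ^ 15, 12, by norm_num, by norm_num, ?_⟩
  intro k n ℓ H hk hkℓ hℓn hH m₀ h hm₀ hh hcard
  have hℓ0 : (0 : ℝ) < ℓ := by exact_mod_cast (by omega : 0 < ℓ)
  have hn0 : (0 : ℝ) < n := by exact_mod_cast (by omega : 0 < n)
  have hlg1 : 1 ≤ Real.logb 2 n := by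
    rw [Real.le_logb_iff_rpow_le (by norm_num) hn0, Real.rpow_one]
    exact_mod_cast (by omega : 2 ≤ n)
  have hh0 : 0 < h := by rw [hh]; positivity
  have hm₀0 : 0 ≤ m₀ := by rw [hm₀]; positivity
  refine exists_disjoint_isEvenCover H hh0.le (fun H' hH' hc => ?_) hcard _ ?_
  · rw [hh]
    refine exists_isEvenCover_of_dense H' hk hkℓ hℓn (fun C hC => hH C (hH' hC)) (le_trans ?_ hc)
    rw [hm₀]
    gcongr
    exact le_self_pow₀ hlg1 (by omega)
  · exact (le_div_iff₀ hh0).1 (Nat.floor_le (by positivity))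
end
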